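/- arXiv:2412.01318 — 12 statements merged into one kernel-verified Lean document; each statement's English description precedes it below -/
import Mathlib

section
/- Let σ ≥ 0 be an integer and set n = 1 + 2σ. For any nonzero real numbers ℓ1, ℓ2 and any positive real numbers β1, β2, c1, c2, ε0, there exists a constant C > 0 such that for all t > 0 one has I(t;n) ≤ C(1+t). -/
open MeasureTheory Real

/-- The double diffusion waves integral `I(t;n)` with singularity parameter `σ`. -/
noncomputable def ddwIntegral (ℓ1 ℓ2 β1 β2 c1 c2 ε0 : ℝ) (σ n : ℕ) (t : ℝ) : ℝ :=
  ∫ r in Set.Ioc (0 : ℝ) ε0,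
    |ℓ1 * (Real.sin (β1 * r * t) / (β1 * r)) * Real.exp (-(c1 * r ^ 2 * t))
      - ℓ2 * (Real.sin (β2 * r * t) / (β2 * r)) * Real.exp (-(c2 * r ^ 2 * t))| ^ 2
      * r ^ ((n : ℝ) - 1 - 2 * (σ : ℝ))

/-- A single damped sine mode is dominated, in square, by a Lorentzian profile. -/
lemma sq_sin_mode_le {ℓ β c r t : ℝ} (hβ : 0 < β) (hc : 0 < c) (hr : 0 < r) (ht : 0 < t) :
    (ℓ * (sin (β * r * t) / (β * r)) * exp (-(c * r ^ 2 * t))) ^ 2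
      ≤ 2 * ℓ ^ 2 * t ^ 2 * (1 + (β * t * r) ^ 2)⁻¹ := by
  have hexp : exp (-(c * r ^ 2 * t)) ^ 2 ≤ 1 := by
    apply pow_le_one₀ (exp_pos _).le
    rw [exp_le_one_iff]
    have : 0 < c * r ^ 2 * t := by positivity
    linarith
  have hsin : (sin (β * r * t) / (β * r)) ^ 2 ≤ 2 * t ^ 2 * (1 + (β * t * r) ^ 2)⁻¹ := by
    have h1 : sin (β * r * t) ^ 2 ≤ (β * r * t) ^ 2 := sq_le_sq.mpr abs_sin_le_abs
    have h2 : sin (β * r * t) ^ 2 ≤ 1 := sin_sq_le_one _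
    rw [div_pow, ← div_eq_mul_inv, div_le_div_iff₀ (by positivity) (by positivity)]
    nlinarith [mul_le_mul_of_nonneg_left h2 (sq_nonneg (β * r * t))]
  calc (ℓ * (sin (β * r * t) / (β * r)) * exp (-(c * r ^ 2 * t))) ^ 2
      = ℓ ^ 2 * (sin (β * r * t) / (β * r)) ^ 2 * exp (-(c * r ^ 2 * t)) ^ 2 := by ring
    _ ≤ ℓ ^ 2 * (sin (β * r * t) / (β * r)) ^ 2 := mul_le_of_le_one_right (by positivity) hexp
    _ ≤ ℓ ^ 2 * (2 * t ^ 2 * (1 + (β * t * r) ^ 2)⁻¹) := by gcongr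
    _ = _ := by ring

lemma integrable_lorentzian {a : ℝ} (ha : 0 < a) :
    Integrable fun r : ℝ => (1 + (a * r) ^ 2)⁻¹ :=
  integrable_inv_one_add_sq.comp_mul_left' ha.ne'

lemma setIntegral_lorentzian_le {a : ℝ} (ha : 0 < a) (s : Set ℝ) :
    ∫ r in s, (1 + (a * r) ^ 2)⁻¹ ≤ π / a := by
  calc ∫ r in s, (1 + (a * r) ^ 2)⁻¹
      ≤ ∫ r : ℝ, (1 + (a * r) ^ 2)⁻¹ :=
        setIntegral_le_integral (integrable_lorentzian ha)
          (Filter.Eventually.of_forall fun r => by positivity)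
    _ = π / a := by
        rw [Measure.integral_comp_mul_left (fun x : ℝ => (1 + x ^ 2)⁻¹) a,
          integral_univ_inv_one_add_sq, abs_of_pos (inv_pos.mpr ha), smul_eq_mul]
        ring

theorem ddw_upper_bound_low_dim (σ n : ℕ) (hn : n = 1 + 2 * σ)
    (ℓ1 ℓ2 β1 β2 c1 c2 ε0 : ℝ) (hℓ1 : ℓ1 ≠ 0) (hℓ2 : ℓ2 ≠ 0)
    (hβ1 : 0 < β1) (hβ2 : 0 < β2) (hc1 : 0 < c1) (hc2 : 0 < c2) (hε0 : 0 < ε0) :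
    ∃ C > 0, ∀ t > 0,
      ddwIntegral ℓ1 ℓ2 β1 β2 c1 c2 ε0 σ n t ≤ C * (1 + t) := by
  refine ⟨4 * ℓ1 ^ 2 * π / β1 + 4 * ℓ2 ^ 2 * π / β2, by positivity, fun t ht => ?_⟩
  have hexponent : (n : ℝ) - 1 - 2 * (σ : ℝ) = 0 := by
    rw [hn]; push_cast; ring
  simp only [ddwIntegral, hexponent, rpow_zero, mul_one, sq_abs]
  have hi1 := ((integrable_lorentzian (mul_pos hβ1 ht)).const_mul
    (4 * ℓ1 ^ 2 * t ^ 2)).integrableOn (s := Set.Ioc 0 ε0)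
  have hi2 := ((integrable_lorentzian (mul_pos hβ2 ht)).const_mul
    (4 * ℓ2 ^ 2 * t ^ 2)).integrableOn (s := Set.Ioc 0 ε0)
  calc _ ≤ ∫ r in Set.Ioc 0 ε0, (4 * ℓ1 ^ 2 * t ^ 2 * (1 + (β1 * t * r) ^ 2)⁻¹
          + 4 * ℓ2 ^ 2 * t ^ 2 * (1 + (β2 * t * r) ^ 2)⁻¹) := by
        refine integral_mono_of_nonneg (Filter.Eventually.of_forall fun r => sq_nonneg _)
          (hi1.add hi2) ?_
        filter_upwards [ae_restrict_mem measurableSet_Ioc] with r hr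
        have h1 := sq_sin_mode_le (ℓ := ℓ1) hβ1 hc1 hr.1 ht
        have h2 := sq_sin_mode_le (ℓ := ℓ2) hβ2 hc2 hr.1 ht
        have hsub (x y : ℝ) : (x - y) ^ 2 ≤ 2 * x ^ 2 + 2 * y ^ 2 := by
          linarith [sq_nonneg (x + y), sub_sq x y, add_sq x y]
        refine (hsub _ _).trans ?_
        linarith
    _ = 4 * ℓ1 ^ 2 * t ^ 2 * (∫ r in Set.Ioc 0 ε0, (1 + (β1 * t * r) ^ 2)⁻¹)
          + 4 * ℓ2 ^ 2 * t ^ 2 * (∫ r in Set.Ioc 0 ε0, (1 + (β2 * t * r) ^ 2)⁻¹) := by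
        rw [integral_add hi1 hi2, integral_const_mul, integral_const_mul]
    _ ≤ 4 * ℓ1 ^ 2 * t ^ 2 * (π / (β1 * t)) + 4 * ℓ2 ^ 2 * t ^ 2 * (π / (β2 * t)) := by
        gcongr
        · exact setIntegral_lorentzian_le (mul_pos hβ1 ht) _
        · exact setIntegral_lorentzian_le (mul_pos hβ2 ht) _
    _ = (4 * ℓ1 ^ 2 * π / β1 + 4 * ℓ2 ^ 2 * π / β2) * t := by
        field_simp
    _ ≤ _ := by
        gcongr
        linarith
end

section
/- Let σ ≥ 0 be an integer and set n = 2 + 2σ. For any nonzero real numbers ℓ1, ℓ2 and any positive real numbers β1, β2, c1, c2, ε0, there exists a constant C > 0 such that for all t > 0 one has I(t;n) ≤ C·log(e+t). -/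
open MeasureTheory Real

/-- The low-frequency bound `|sin| ≤ β r t` and the bound `|sin| ≤ 1`, combined into one. -/
lemma abs_sin_div_le {β r t : ℝ} (hβ : 0 < β) (hr : 0 < r) (ht : 0 < t) :
    |Real.sin (β * r * t) / (β * r)| ≤ (1 + 1 / β) * (t / (1 + r * t)) := by
  have hβr : 0 < β * r := mul_pos hβ hr
  have h1 : |Real.sin (β * r * t)| ≤ 1 := Real.abs_sin_le_one _
  have h2 : |Real.sin (β * r * t)| ≤ β * r * t := by
    simpa [abs_of_pos (mul_pos hβr ht)] using Real.abs_sin_le_abs (x := β * r * t)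
  rw [abs_div, abs_of_pos hβr, ← mul_div_assoc, div_le_div_iff₀ hβr (by positivity)]
  have h3 : (1 + 1 / β) * t * (β * r) = β * r * t + 1 * (r * t) := by
    field_simp
  rw [h3, mul_add, mul_one]
  gcongr

lemma abs_wave_term_le {ℓ β c r t : ℝ} (hβ : 0 < β) (hc : 0 < c) (hr : 0 < r) (ht : 0 < t) :
    |ℓ * (Real.sin (β * r * t) / (β * r)) * Real.exp (-(c * r ^ 2 * t))|
      ≤ |ℓ| * (1 + 1 / β) * (t / (1 + r * t)) := by
  have hexp : Real.exp (-(c * r ^ 2 * t)) ≤ 1 :=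
    Real.exp_le_one_iff.2 (neg_nonpos.2 (by positivity))
  rw [abs_mul, abs_mul, Real.abs_exp, mul_assoc |ℓ| (1 + 1 / β)]
  calc _ ≤ |ℓ| * |Real.sin (β * r * t) / (β * r)| * 1 := by gcongr
    _ ≤ _ := by rw [mul_one]; gcongr; exact abs_sin_div_le hβ hr ht

lemma continuousOn_div_one_add_mul {t : ℝ} (ht : 0 < t) (a : ℝ) :
    ContinuousOn (fun r : ℝ => t / (1 + r * t)) (Set.Icc 0 a) := by
  refine ContinuousOn.div (by fun_prop) (by fun_prop) fun r hr => ?_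
  have := mul_nonneg hr.1 ht.le
  positivity

lemma integral_div_one_add_mul {t a : ℝ} (ht : 0 < t) (ha : 0 < a) :
    ∫ r in Set.Ioc 0 a, t / (1 + r * t) = Real.log (1 + a * t) := by
  rw [← intervalIntegral.integral_of_le ha.le,
    intervalIntegral.integral_eq_sub_of_hasDerivAt (f := fun r => Real.log (1 + r * t))]
  · simp
  · intro r hr
    rw [Set.uIcc_of_le ha.le] at hr
    have h0 : 0 ≤ r * t := mul_nonneg hr.1 ht.le
    have h : HasDerivAt (fun r : ℝ => 1 + r * t) t r := by
      simpa using ((hasDerivAt_id r).mul_const t).const_add 1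
    exact h.log (by positivity)
  · refine ContinuousOn.intervalIntegrable ?_
    rw [Set.uIcc_of_le ha.le]
    exact continuousOn_div_one_add_mul ht a

lemma log_one_add_mul_le {a t : ℝ} (ha : 0 < a) (ht : 0 < t) :
    Real.log (1 + a * t) ≤ (Real.log (1 + a) + 1) * Real.log (Real.exp 1 + t) := by
  have he : 1 ≤ Real.exp 1 := Real.one_le_exp zero_le_one
  have h1 : 1 ≤ Real.log (Real.exp 1 + t) := by
    rw [Real.le_log_iff_exp_le (by positivity)]
    linarith
  have h2 : 0 ≤ Real.log (1 + a) := Real.log_nonneg (by linarith)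
  calc Real.log (1 + a * t) ≤ Real.log ((1 + a) * (Real.exp 1 + t)) := by
        apply Real.log_le_log (by positivity)
        nlinarith [mul_pos ha ht, mul_pos ha (Real.exp_pos 1)]
    _ = Real.log (1 + a) + Real.log (Real.exp 1 + t) :=
        Real.log_mul (by positivity) (by positivity)
    _ ≤ _ := by nlinarith

lemma ddw_integrand_le {ℓ1 ℓ2 β1 β2 c1 c2 r t : ℝ} (hβ1 : 0 < β1) (hβ2 : 0 < β2)
    (hc1 : 0 < c1) (hc2 : 0 < c2) (hr : 0 < r) (ht : 0 < t) :
    |ℓ1 * (Real.sin (β1 * r * t) / (β1 * r)) * Real.exp (-(c1 * r ^ 2 * t))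
      - ℓ2 * (Real.sin (β2 * r * t) / (β2 * r)) * Real.exp (-(c2 * r ^ 2 * t))| ^ 2 * r
      ≤ (|ℓ1| * (1 + 1 / β1) + |ℓ2| * (1 + 1 / β2)) ^ 2 * (t / (1 + r * t)) := by
  have hq : t / (1 + r * t) * r ≤ 1 := by
    rw [div_mul_eq_mul_div, div_le_one (by positivity)]
    linarith
  calc _ ≤ ((|ℓ1| * (1 + 1 / β1) + |ℓ2| * (1 + 1 / β2)) * (t / (1 + r * t))) ^ 2 * r := by
        gcongr
        refine (abs_sub _ _).trans ?_
        rw [add_mul]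
        exact add_le_add (abs_wave_term_le hβ1 hc1 hr ht) (abs_wave_term_le hβ2 hc2 hr ht)
    _ = (|ℓ1| * (1 + 1 / β1) + |ℓ2| * (1 + 1 / β2)) ^ 2 * (t / (1 + r * t))
          * (t / (1 + r * t) * r) := by ring
    _ ≤ _ := mul_le_of_le_one_right (by positivity) hq

theorem ddw_upper_bound_critical_dim (σ n : ℕ) (hn : n = 2 + 2 * σ)
    (ℓ1 ℓ2 β1 β2 c1 c2 ε0 : ℝ) (hℓ1 : ℓ1 ≠ 0) (hℓ2 : ℓ2 ≠ 0)
    (hβ1 : 0 < β1) (hβ2 : 0 < β2) (hc1 : 0 < c1) (hc2 : 0 < c2) (hε0 : 0 < ε0) :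
    ∃ C > 0, ∀ t > 0,
      ddwIntegral ℓ1 ℓ2 β1 β2 c1 c2 ε0 σ n t ≤ C * Real.log (Real.exp 1 + t) := by
  have hexp : (n : ℝ) - 1 - 2 * (σ : ℝ) = 1 := by
    rw [hn]
    push_cast
    ring
  set K := (|ℓ1| * (1 + 1 / β1) + |ℓ2| * (1 + 1 / β2)) ^ 2 with hK
  have hKpos : 0 < K := by
    have := abs_pos.2 hℓ1
    positivity
  have hlog : 0 ≤ Real.log (1 + ε0) := Real.log_nonneg (by linarith)
  refine ⟨K * (Real.log (1 + ε0) + 1), by positivity, fun t ht => ?_⟩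
  calc ddwIntegral ℓ1 ℓ2 β1 β2 c1 c2 ε0 σ n t
      ≤ ∫ r in Set.Ioc 0 ε0, K * (t / (1 + r * t)) := by
        unfold ddwIntegral
        simp only [hexp, Real.rpow_one]
        refine integral_mono_of_nonneg ?_ ?_ ?_
        · filter_upwards [ae_restrict_mem measurableSet_Ioc] with r hr
          exact mul_nonneg (by positivity) hr.1.le
        · exact ((continuousOn_div_one_add_mul ht ε0).integrableOn_Icc.mono_set
            Set.Ioc_subset_Icc_self).const_mul K
        · filter_upwards [ae_restrict_mem measurableSet_Ioc] with r hr
          exact ddw_integrand_le hβ1 hβ2 hc1 hc2 hr.1 ht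
    _ = K * Real.log (1 + ε0 * t) := by
        rw [integral_const_mul, integral_div_one_add_mul ht hε0]
    _ ≤ K * (Real.log (1 + ε0) + 1) * Real.log (Real.exp 1 + t) := by
        rw [mul_assoc]
        exact mul_le_mul_of_nonneg_left (log_one_add_mul_le hε0 ht) hKpos.le
end

section
/- Let σ ≥ 0 be an integer and let n be an integer with n ≥ 3 + 2σ. For any nonzero real numbers ℓ1, ℓ2 and any positive real numbers β1, β2, c1, c2, ε0, there exists a constant C > 0 such that for all t > 0 one has I(t;n) ≤ C·(1+t)^{1+σ−n/2}. -/
open MeasureTheory Real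

/-- A single diffusion wave profile is dominated by a Gaussian of smaller rate over `r`. -/
lemma abs_diffusionWave_le (ℓ β c d r t : ℝ) (hβ : 0 < β) (hd : d ≤ c) (hr : 0 < r)
    (ht : 0 < t) :
    |ℓ * (Real.sin (β * r * t) / (β * r)) * Real.exp (-(c * r ^ 2 * t))|
      ≤ |ℓ| / β * (Real.exp (-(d * r ^ 2 * t)) / r) := by
  have hexp : Real.exp (-(c * r ^ 2 * t)) ≤ Real.exp (-(d * r ^ 2 * t)) := by
    gcongr
  rw [abs_mul, abs_mul, abs_div, abs_of_pos (mul_pos hβ hr), Real.abs_exp]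
  calc |ℓ| * (|Real.sin (β * r * t)| / (β * r)) * Real.exp (-(c * r ^ 2 * t))
      ≤ |ℓ| * (1 / (β * r)) * Real.exp (-(d * r ^ 2 * t)) := by
        gcongr
        exact Real.abs_sin_le_one _
    _ = |ℓ| / β * (Real.exp (-(d * r ^ 2 * t)) / r) := by
        field_simp

/-- Shifting the time by one costs only a constant on bounded frequencies. -/
lemma exp_neg_mul_sq_le_shift (d ε r t : ℝ) (hd : 0 < d) (hr : 0 < r) (hrε : r ≤ ε) :
    Real.exp (-(d * r ^ 2 * t)) ^ 2
      ≤ Real.exp (2 * d * ε ^ 2) * Real.exp (-(2 * d * (1 + t)) * r ^ (2 : ℝ)) := by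
  rw [← Real.exp_nat_mul, ← Real.exp_add, Real.rpow_two, Real.exp_le_exp]
  have hsq : r ^ 2 ≤ ε ^ 2 := by gcongr
  push_cast
  nlinarith [mul_le_mul_of_nonneg_left hsq hd.le]

theorem ddw_upper_bound_high_dim (σ n : ℕ) (hn : 3 + 2 * σ ≤ n)
    (ℓ1 ℓ2 β1 β2 c1 c2 ε0 : ℝ) (hℓ1 : ℓ1 ≠ 0) (hℓ2 : ℓ2 ≠ 0)
    (hβ1 : 0 < β1) (hβ2 : 0 < β2) (hc1 : 0 < c1) (hc2 : 0 < c2) (hε0 : 0 < ε0) :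
    ∃ C > 0, ∀ t > 0,
      ddwIntegral ℓ1 ℓ2 β1 β2 c1 c2 ε0 σ n t
        ≤ C * (1 + t) ^ (1 + (σ : ℝ) - (n : ℝ) / 2) := by
  have hn' : (3 : ℝ) + 2 * σ ≤ n := by exact_mod_cast hn
  set d := min c1 c2
  have hd : 0 < d := lt_min hc1 hc2
  set q : ℝ := (n : ℝ) - 3 - 2 * σ with hq_def
  have hq : -1 < q := by linarith
  set K : ℝ := |ℓ1| / β1 + |ℓ2| / β2
  have hK : 0 < K := by positivity
  set M : ℝ := K ^ 2 * Real.exp (2 * d * ε0 ^ 2) with hM_def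
  have hM : 0 < M := by positivity
  have hΓ : 0 < Real.Gamma ((q + 1) / 2) := Real.Gamma_pos_of_pos (by linarith)
  refine ⟨M * ((2 * d) ^ (-(q + 1) / 2) * (1 / 2) * Real.Gamma ((q + 1) / 2)),
    by positivity, fun t ht => ?_⟩
  have hb : 0 < 2 * d * (1 + t) := by positivity
  have hint : IntegrableOn
      (fun r : ℝ => M * (r ^ q * Real.exp (-(2 * d * (1 + t)) * r ^ (2 : ℝ)))) (Set.Ioi 0) :=
    (integrableOn_rpow_mul_exp_neg_mul_rpow hq two_pos hb).const_mul M
  have hpt : ∀ r ∈ Set.Ioc (0 : ℝ) ε0,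
      |ℓ1 * (Real.sin (β1 * r * t) / (β1 * r)) * Real.exp (-(c1 * r ^ 2 * t))
        - ℓ2 * (Real.sin (β2 * r * t) / (β2 * r)) * Real.exp (-(c2 * r ^ 2 * t))| ^ 2
        * r ^ ((n : ℝ) - 1 - 2 * (σ : ℝ))
      ≤ M * (r ^ q * Real.exp (-(2 * d * (1 + t)) * r ^ (2 : ℝ))) := by
    rintro r ⟨hr, hrε⟩
    have habs := (abs_sub _ _).trans (add_le_add
      (abs_diffusionWave_le ℓ1 β1 c1 d r t hβ1 (min_le_left _ _) hr ht)
      (abs_diffusionWave_le ℓ2 β2 c2 d r t hβ2 (min_le_right _ _) hr ht))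
    rw [← add_mul] at habs
    have hpow : r ^ ((n : ℝ) - 1 - 2 * (σ : ℝ)) = r ^ q * r ^ 2 := by
      rw [← Real.rpow_two, ← Real.rpow_add hr]
      congr 1
      rw [hq_def]
      ring
    rw [hpow]
    calc _ ≤ (K * (Real.exp (-(d * r ^ 2 * t)) / r)) ^ 2 * (r ^ q * r ^ 2) := by gcongr
      _ = K ^ 2 * r ^ q * Real.exp (-(d * r ^ 2 * t)) ^ 2 := by field_simp
      _ ≤ K ^ 2 * r ^ q *
          (Real.exp (2 * d * ε0 ^ 2) * Real.exp (-(2 * d * (1 + t)) * r ^ (2 : ℝ))) := by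
        gcongr
        exact exp_neg_mul_sq_le_shift d ε0 r t hd hr hrε
      _ = _ := by rw [hM_def]; ring
  calc ddwIntegral ℓ1 ℓ2 β1 β2 c1 c2 ε0 σ n t
      ≤ ∫ r in Set.Ioc (0 : ℝ) ε0,
          M * (r ^ q * Real.exp (-(2 * d * (1 + t)) * r ^ (2 : ℝ))) := by
        refine integral_mono_of_nonneg ?_ (hint.mono_set Set.Ioc_subset_Ioi_self) ?_
        · filter_upwards [ae_restrict_mem measurableSet_Ioc] with r hr
          have := hr.1
          simp only [Pi.zero_apply]
          positivity
        · filter_upwards [ae_restrict_mem measurableSet_Ioc] with r hr using hpt r hr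
    _ ≤ ∫ r in Set.Ioi (0 : ℝ),
          M * (r ^ q * Real.exp (-(2 * d * (1 + t)) * r ^ (2 : ℝ))) := by
        refine setIntegral_mono_set hint ?_ Set.Ioc_subset_Ioi_self.eventuallyLE
        filter_upwards [ae_restrict_mem measurableSet_Ioi] with r hr
        have : 0 < r := hr
        simp only [Pi.zero_apply]
        positivity
    _ = _ := by
        rw [integral_const_mul, integral_rpow_mul_exp_neg_mul_rpow (by norm_num) hq hb,
          Real.mul_rpow (by positivity) (by positivity)]
        have hexp : -(q + 1) / 2 = 1 + (σ : ℝ) - (n : ℝ) / 2 := by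
          rw [hq_def]
          ring
        rw [hexp]
        ring
end

section
/- Let σ ≥ 0 be an integer and set n = 1 + 2σ. Let ℓ1, ℓ2 be nonzero reals with ℓ1² ≠ ℓ2², and let β1, β2, c1, c2, ε0 > 0 with c1 ≠ c2. Then there exist constants c > 0 and T > 0 such that I(t;n) ≥ c·t for all t ≥ T. -/
open MeasureTheory Real

/-- The rescaled amplitude: the double diffusion waves multiplier at frequency `s / t` equals
`t` times this amplitude at `(s, 1 / t)`. -/
noncomputable def ddwAmplitude (ℓ1 ℓ2 β1 β2 c1 c2 : ℝ) (p : ℝ × ℝ) : ℝ :=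
  ℓ1 * sinc (β1 * p.1) * exp (-(c1 * p.1 ^ 2 * p.2))
    - ℓ2 * sinc (β2 * p.1) * exp (-(c2 * p.1 ^ 2 * p.2))

lemma continuous_ddwAmplitude (ℓ1 ℓ2 β1 β2 c1 c2 : ℝ) :
    Continuous (ddwAmplitude ℓ1 ℓ2 β1 β2 c1 c2) := by
  have h1 : Continuous fun p : ℝ × ℝ => sinc (β1 * p.1) := continuous_sinc.comp (by fun_prop)
  have h2 : Continuous fun p : ℝ × ℝ => sinc (β2 * p.1) := continuous_sinc.comp (by fun_prop)
  unfold ddwAmplitude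
  fun_prop

lemma sin_div_eq_mul_sinc {β r t : ℝ} (hβ : β ≠ 0) (hr : r ≠ 0) (ht : t ≠ 0) :
    sin (β * r * t) / (β * r) = t * sinc (β * (r * t)) := by
  rw [sinc_of_ne_zero (by positivity), ← mul_assoc]
  field_simp

lemma ddwIntegral_eq_setIntegral_ddwAmplitude {ℓ1 ℓ2 β1 β2 c1 c2 ε0 t : ℝ} {σ n : ℕ}
    (hn : n = 1 + 2 * σ) (hβ1 : β1 ≠ 0) (hβ2 : β2 ≠ 0) (ht : t ≠ 0) :
    ddwIntegral ℓ1 ℓ2 β1 β2 c1 c2 ε0 σ n t =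
      ∫ r in Set.Ioc (0 : ℝ) ε0, t ^ 2 * ddwAmplitude ℓ1 ℓ2 β1 β2 c1 c2 (r * t, t⁻¹) ^ 2 := by
  refine setIntegral_congr_fun measurableSet_Ioc fun r hr => ?_
  have he : (n : ℝ) - 1 - 2 * (σ : ℝ) = 0 := by subst hn; push_cast; ring
  have hexp (c : ℝ) : c * (r * t) ^ 2 * t⁻¹ = c * r ^ 2 * t := by field_simp
  simp only [he, rpow_zero, mul_one, sq_abs, ddwAmplitude, hexp,
    sin_div_eq_mul_sinc hβ1 hr.1.ne' ht, sin_div_eq_mul_sinc hβ2 hr.1.ne' ht]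
  ring

theorem ddw_lower_bound_low_dim (σ n : ℕ) (hn : n = 1 + 2 * σ)
    (ℓ1 ℓ2 β1 β2 c1 c2 ε0 : ℝ) (hℓ1 : ℓ1 ≠ 0) (hℓ2 : ℓ2 ≠ 0)
    (hℓ : ℓ1 ^ 2 ≠ ℓ2 ^ 2)
    (hβ1 : 0 < β1) (hβ2 : 0 < β2) (hc1 : 0 < c1) (hc2 : 0 < c2)
    (hc : c1 ≠ c2) (hε0 : 0 < ε0) :
    ∃ c > 0, ∃ T > 0, ∀ t ≥ T,
      c * t ≤ ddwIntegral ℓ1 ℓ2 β1 β2 c1 c2 ε0 σ n t := by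
  have hne : ℓ1 - ℓ2 ≠ 0 := fun h => hℓ (by rw [sub_eq_zero.mp h])
  set G := ddwAmplitude ℓ1 ℓ2 β1 β2 c1 c2 with hG
  have hGc : Continuous G := continuous_ddwAmplitude ..
  have hG0 : G (0, 0) = ℓ1 - ℓ2 := by simp [hG, ddwAmplitude]
  have hm : 0 < (ℓ1 - ℓ2) ^ 2 / 2 := by positivity
  set m := (ℓ1 - ℓ2) ^ 2 / 2 with hm_def
  have hnear : ∀ᶠ p in nhds ((0 : ℝ), (0 : ℝ)), m < G p ^ 2 := by
    refine (hGc.pow 2).continuousAt.eventually_const_lt ?_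
    simp only [Pi.pow_apply, hG0]
    linarith
  obtain ⟨δ, hδ, hball⟩ := Metric.eventually_nhds_iff.mp hnear
  refine ⟨m * (δ / 2), by positivity, max (2 / δ) (δ / (2 * ε0)), by positivity, fun t ht => ?_⟩
  have ht1 : 2 / δ ≤ t := (le_max_left _ _).trans ht
  have ht2 : δ / (2 * ε0) ≤ t := (le_max_right _ _).trans ht
  have ht0 : 0 < t := lt_of_lt_of_le (by positivity) ht1
  have hinv : t⁻¹ < δ := by
    rw [inv_lt_comm₀ ht0 hδ]
    refine lt_of_lt_of_le ?_ ht1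
    rw [inv_eq_one_div]
    gcongr
    norm_num
  have hsub : δ / (2 * t) ≤ ε0 := by
    rw [div_le_iff₀ (by positivity)] at ht2 ⊢
    linarith
  rw [ddwIntegral_eq_setIntegral_ddwAmplitude hn hβ1.ne' hβ2.ne' ht0.ne']
  have hcont : Continuous fun r : ℝ => t ^ 2 * G (r * t, t⁻¹) ^ 2 := by fun_prop
  have hint : IntegrableOn (fun r : ℝ => t ^ 2 * G (r * t, t⁻¹) ^ 2) (Set.Ioc 0 ε0) :=
    hcont.integrableOn_Ioc
  have hIoc : Set.Ioc 0 (δ / (2 * t)) ⊆ Set.Ioc 0 ε0 := Set.Ioc_subset_Ioc_right hsub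
  calc m * (δ / 2) * t = ∫ _ in Set.Ioc (0 : ℝ) (δ / (2 * t)), t ^ 2 * m := by
        rw [setIntegral_const, measureReal_def, Real.volume_Ioc,
          ENNReal.toReal_ofReal (by rw [sub_zero]; positivity), smul_eq_mul]
        field_simp
        ring
    _ ≤ ∫ r in Set.Ioc (0 : ℝ) (δ / (2 * t)), t ^ 2 * G (r * t, t⁻¹) ^ 2 := by
        refine setIntegral_mono_on continuous_const.integrableOn_Ioc (hint.mono_set hIoc)
          measurableSet_Ioc fun r hr => ?_
        refine mul_le_mul_of_nonneg_left (hball ?_).le (by positivity)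
        have hrt : r * t < δ := by
          have := (le_div_iff₀ (by positivity)).mp hr.2
          linarith
        have hrt0 : 0 < r * t := mul_pos hr.1 ht0
        rw [Prod.dist_eq, max_lt_iff]
        simp only [Real.dist_eq, sub_zero]
        rw [abs_of_pos hrt0, abs_of_pos (inv_pos.mpr ht0)]
        exact ⟨hrt, hinv⟩
    _ ≤ ∫ r in Set.Ioc (0 : ℝ) ε0, t ^ 2 * G (r * t, t⁻¹) ^ 2 :=
        setIntegral_mono_set hint (ae_of_all _ fun r => by positivity) hIoc.eventuallyLE
end

section
/- Let σ ≥ 0 be an integer and set n = 2 + 2σ. Let ℓ1, ℓ2 be nonzero reals and β1, β2, c1, c2, ε0 > 0 with c1 ≠ c2, and assume either ℓ1²β2² > 2ℓ2²β1² or ℓ2²β1² > 2ℓ1²β2². Then there exist constants c > 0 and T > 1 such that I(t;n) ≥ c·log t for all t ≥ T. -/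
open MeasureTheory Real

/-- The derivative of `s ↦ (sin (ω s) + e) / (ω s)` is `cos (ω s) / s` up to an integrable
correction, whose sign is controlled by `e = 1` or `e = -1`. -/
lemma hasDerivAt_sin_add_div {ω s : ℝ} (hω : ω ≠ 0) (hs : s ≠ 0) (e : ℝ) :
    HasDerivAt (fun s => (Real.sin (ω * s) + e) / (ω * s))
      (Real.cos (ω * s) / s - (Real.sin (ω * s) + e) / (ω * s ^ 2)) s := by
  have h1 : HasDerivAt (fun s : ℝ => ω * s) ω s := by
    simpa using (hasDerivAt_id s).const_mul ω
  have h := (h1.sin.add_const e).div h1 (mul_ne_zero hω hs)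
  refine h.congr_deriv ?_
  field_simp

/-- A function dominating `(p sin² (β₁ t r) - q sin² (β₂ t r)) / r` has an integral
that grows at least like `(p - q) / 2 * log`. -/
lemma exists_log_sub_le_integral {p q β1 β2 : ℝ} (hp : 0 ≤ p) (hq : 0 ≤ q)
    (hβ1 : 0 < β1) (hβ2 : 0 < β2) :
    ∃ C : ℝ, ∀ t > 0, ∀ R, 1 / t ≤ R → ∀ f : ℝ → ℝ,
      IntegrableOn f (Set.Icc (1 / t) R) →
      (∀ r ∈ Set.Ioo (1 / t) R,
        (p * Real.sin (β1 * r * t) ^ 2 - q * Real.sin (β2 * r * t) ^ 2) / r ≤ f r) →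
      (p - q) / 2 * Real.log (R * t) - C ≤ ∫ r in (1 / t)..R, f r := by
  set Φ : ℝ → ℝ := fun s => (p - q) / 2 * Real.log s
    - p / 2 * ((Real.sin (2 * β1 * s) + (-1)) / (2 * β1 * s))
    + q / 2 * ((Real.sin (2 * β2 * s) + 1) / (2 * β2 * s)) with hΦ
  have hderiv : ∀ s > 0, ∃ d, HasDerivAt Φ d s ∧
      d ≤ (p * Real.sin (β1 * s) ^ 2 - q * Real.sin (β2 * s) ^ 2) / s := by
    intro s hs
    refine ⟨_, (((Real.hasDerivAt_log hs.ne').const_mul _).sub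
      ((hasDerivAt_sin_add_div (by positivity) hs.ne' _).const_mul _)).add
      ((hasDerivAt_sin_add_div (by positivity) hs.ne' _).const_mul _), ?_⟩
    have e1 : (Real.sin (2 * β1 * s) + (-1)) / (2 * β1 * s ^ 2) ≤ 0 :=
      div_nonpos_of_nonpos_of_nonneg (by linarith [Real.sin_le_one (2 * β1 * s)]) (by positivity)
    have e2 : 0 ≤ (Real.sin (2 * β2 * s) + 1) / (2 * β2 * s ^ 2) :=
      div_nonneg (by linarith [Real.neg_one_le_sin (2 * β2 * s)]) (by positivity)
    have hsin : ∀ β : ℝ, Real.sin (β * s) ^ 2 = (1 - Real.cos (2 * β * s)) / 2 := by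
      intro β
      rw [Real.sin_sq_eq_half_sub, mul_assoc]
      ring
    have key : (p * Real.sin (β1 * s) ^ 2 - q * Real.sin (β2 * s) ^ 2) / s
        = (p - q) / 2 * s⁻¹ - p / 2 * (Real.cos (2 * β1 * s) / s)
          + q / 2 * (Real.cos (2 * β2 * s) / s) := by
      rw [hsin, hsin]
      field_simp
      ring
    rw [key]
    nlinarith [mul_nonneg hp (neg_nonneg.2 e1), mul_nonneg hq e2]
  choose! d hd hdle using hderiv
  refine ⟨Φ 1, fun t ht R hR f hf hfle => ?_⟩
  have ht1 : 0 < 1 / t := by positivity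
  have hR0 : 0 < R := ht1.trans_le hR
  have hder : ∀ r > 0, HasDerivAt (fun r => Φ (r * t)) (d (r * t) * t) r := fun r hr =>
    HasDerivAt.comp (h₂ := Φ) r (hd (r * t) (by positivity))
      (by simpa using (hasDerivAt_id r).mul_const t)
  have hmain := intervalIntegral.sub_le_integral_of_hasDeriv_right_of_le hR
    (fun r hr => (hder r (ht1.trans_le hr.1)).continuousAt.continuousWithinAt)
    (fun r hr => (hder r (ht1.trans hr.1)).hasDerivWithinAt) hf
    (fun r hr => by
      have hr0 : 0 < r := ht1.trans hr.1
      refine le_trans ?_ (hfle r hr)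
      have := mul_le_mul_of_nonneg_right (hdle (r * t) (by positivity)) ht.le
      refine this.trans_eq ?_
      rw [mul_assoc, mul_assoc]
      field_simp)
  have hone : 1 / t * t = 1 := by field_simp
  simp only [hone] at hmain
  refine le_trans (sub_le_sub_right ?_ _) hmain
  have hs : 0 < R * t := by positivity
  have e1 : (Real.sin (2 * β1 * (R * t)) + (-1)) / (2 * β1 * (R * t)) ≤ 0 :=
    div_nonpos_of_nonpos_of_nonneg (by linarith [Real.sin_le_one (2 * β1 * (R * t))])
      (by positivity)
  have e2 : 0 ≤ (Real.sin (2 * β2 * (R * t)) + 1) / (2 * β2 * (R * t)) :=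
    div_nonneg (by linarith [Real.neg_one_le_sin (2 * β2 * (R * t))]) (by positivity)
  simp only [hΦ]
  nlinarith [mul_nonneg hp (neg_nonneg.2 e1), mul_nonneg hq e2]

lemma ddwIntegral_swap (ℓ1 ℓ2 β1 β2 c1 c2 ε0 : ℝ) (σ n : ℕ) (t : ℝ) :
    ddwIntegral ℓ1 ℓ2 β1 β2 c1 c2 ε0 σ n t = ddwIntegral ℓ2 ℓ1 β2 β1 c2 c1 ε0 σ n t := by
  simp only [ddwIntegral, abs_sub_comm]

/-- In the critical dimension the integrand is integrable near the origin. -/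
lemma integrableOn_ddw_integrand (ℓ1 ℓ2 c1 c2 ε0 : ℝ) {β1 β2 : ℝ} (hβ1 : 0 < β1)
    (hβ2 : 0 < β2) (t : ℝ) :
    IntegrableOn (fun r =>
      |ℓ1 * (Real.sin (β1 * r * t) / (β1 * r)) * Real.exp (-(c1 * r ^ 2 * t))
      - ℓ2 * (Real.sin (β2 * r * t) / (β2 * r)) * Real.exp (-(c2 * r ^ 2 * t))| ^ 2 * r)
      (Set.Ioc 0 ε0) := by
  have hsinc : ∀ β > 0, ∀ r > 0,
      Real.sin (β * r * t) / (β * r) = t * Real.sinc (β * r * t) := by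
    intro β hβ r hr
    rcases eq_or_ne t 0 with rfl | ht
    · simp
    · rw [Real.sinc_of_ne_zero (by positivity)]
      field_simp
  have hcont : Continuous (fun r =>
      |ℓ1 * (t * Real.sinc (β1 * r * t)) * Real.exp (-(c1 * r ^ 2 * t))
      - ℓ2 * (t * Real.sinc (β2 * r * t)) * Real.exp (-(c2 * r ^ 2 * t))| ^ 2 * r) := by
    have := Real.continuous_sinc
    fun_prop
  refine (hcont.integrableOn_Ioc (a := 0) (b := ε0)).congr_fun (fun r hr => ?_)
    measurableSet_Ioc
  simp only [hsinc β1 hβ1 r hr.1, hsinc β2 hβ2 r hr.1]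

lemma ddwIntegral_lower_bound_of_gt (σ n : ℕ) (hn : n = 2 + 2 * σ)
    (ℓ1 ℓ2 β1 β2 c1 c2 ε0 : ℝ) (hβ1 : 0 < β1) (hβ2 : 0 < β2) (hc1 : 0 < c1) (hc2 : 0 < c2)
    (hε0 : 0 < ε0) (hcond : ℓ1 ^ 2 * β2 ^ 2 > 2 * ℓ2 ^ 2 * β1 ^ 2) :
    ∃ c > 0, ∃ T > 1, ∀ t ≥ T,
      c * Real.log t ≤ ddwIntegral ℓ1 ℓ2 β1 β2 c1 c2 ε0 σ n t := by
  set a := ℓ1 / β1 with ha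
  set b := ℓ2 / β2 with hb
  have hab : b ^ 2 < a ^ 2 / 2 := by
    rw [ha, hb, div_pow, div_pow, div_div, div_lt_div_iff₀ (by positivity) (by positivity)]
    linarith
  obtain ⟨δ, hδ, hδ0⟩ : ∃ δ, b ^ 2 < a ^ 2 / 2 * Real.exp (-(2 * c1 * δ ^ 2)) ∧ 0 < δ := by
    have hcont : Continuous fun δ : ℝ => a ^ 2 / 2 * Real.exp (-(2 * c1 * δ ^ 2)) := by fun_prop
    have h0 := hcont.tendsto 0
    have h1 : ∀ᶠ δ in nhds (0 : ℝ), b ^ 2 < a ^ 2 / 2 * Real.exp (-(2 * c1 * δ ^ 2)) :=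
      h0.eventually (lt_mem_nhds (by simpa using hab))
    exact ((h1.filter_mono nhdsWithin_le_nhds).and
      (self_mem_nhdsWithin : Set.Ioi (0 : ℝ) ∈ nhdsWithin 0 (Set.Ioi 0))).exists
  set p := a ^ 2 / 2 * Real.exp (-(2 * c1 * δ ^ 2)) with hp
  set q := b ^ 2 with hq
  have hp0 : 0 ≤ p := by positivity
  have hq0 : 0 ≤ q := by positivity
  obtain ⟨C, hC⟩ := exists_log_sub_le_integral hp0 hq0 hβ1 hβ2
  have hpq : 0 < p - q := sub_pos.2 hδ
  refine ⟨(p - q) / 8, by positivity, ?_⟩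
  obtain ⟨T, hT⟩ : ∃ T : ℝ, ∀ t ≥ T, 1 < t ∧ 1 / δ ≤ √t ∧ δ / ε0 ≤ √t ∧
      (C - (p - q) / 2 * Real.log δ) / ((p - q) / 8) ≤ Real.log t := by
    rw [← Filter.eventually_atTop]
    exact (Filter.eventually_gt_atTop 1).and
      ((Real.tendsto_sqrt_atTop.eventually_ge_atTop _).and
      ((Real.tendsto_sqrt_atTop.eventually_ge_atTop _).and
      (Real.tendsto_log_atTop.eventually_ge_atTop _)))
  refine ⟨T, (hT T le_rfl).1, fun t ht => ?_⟩
  obtain ⟨ht1, hsδ, hsε, hlog⟩ := hT t ht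
  have ht0 : 0 < t := one_pos.trans ht1
  have hs0 : 0 < √t := Real.sqrt_pos.2 ht0
  have hss : √t ^ 2 = t := Real.sq_sqrt ht0.le
  have hRt : δ / √t * t = δ * √t := by
    nth_rewrite 2 [← hss]
    field_simp
  have hR : 1 / t ≤ δ / √t := by
    rw [div_le_iff₀ ht0, hRt]
    rwa [div_le_iff₀' hδ0] at hsδ
  have hRε : δ / √t ≤ ε0 := by
    rw [div_le_iff₀ hs0]
    rwa [div_le_iff₀' hε0] at hsε
  have hexp : (n : ℝ) - 1 - 2 * (σ : ℝ) = 1 := by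
    rw [hn]
    push_cast
    ring
  simp only [ddwIntegral, hexp, Real.rpow_one]
  set f : ℝ → ℝ := fun r =>
      |ℓ1 * (Real.sin (β1 * r * t) / (β1 * r)) * Real.exp (-(c1 * r ^ 2 * t))
      - ℓ2 * (Real.sin (β2 * r * t) / (β2 * r)) * Real.exp (-(c2 * r ^ 2 * t))| ^ 2 * r with hf
  have hint : IntegrableOn f (Set.Ioc 0 ε0) :=
    integrableOn_ddw_integrand ℓ1 ℓ2 c1 c2 ε0 hβ1 hβ2 t
  have ht' : 0 < 1 / t := by positivity
  have hbound := hC t ht0 (δ / √t) hR f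
    (hint.mono_set fun r hr => ⟨ht'.trans_le hr.1, hr.2.trans hRε⟩) (fun r hr => by
      have hr0 : 0 < r := ht'.trans hr.1
      have hrt : r ^ 2 * t ≤ δ ^ 2 := by
        have h := mul_self_le_mul_self hr0.le hr.2.le
        calc r ^ 2 * t ≤ (δ / √t * (δ / √t)) * t := by
              rw [sq]
              gcongr
          _ = δ ^ 2 := by
              rw [mul_assoc, hRt]
              field_simp
      have hfr : f r = (a * Real.sin (β1 * r * t) * Real.exp (-(c1 * r ^ 2 * t))
          - b * Real.sin (β2 * r * t) * Real.exp (-(c2 * r ^ 2 * t))) ^ 2 / r := by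
        simp only [hf, sq_abs, ha, hb]
        field_simp
      set S1 := Real.sin (β1 * r * t)
      set S2 := Real.sin (β2 * r * t)
      have hE1 : Real.exp (-(2 * c1 * δ ^ 2)) ≤ Real.exp (-(c1 * r ^ 2 * t)) ^ 2 := by
        rw [← Real.exp_nat_mul]
        apply Real.exp_le_exp.2
        push_cast
        nlinarith
      have hE2 : Real.exp (-(c2 * r ^ 2 * t)) ^ 2 ≤ 1 :=
        pow_le_one₀ (Real.exp_pos _).le (Real.exp_le_one_iff.2 (by
          rw [neg_nonpos]
          positivity))
      set E1 := Real.exp (-(c1 * r ^ 2 * t))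
      set E2 := Real.exp (-(c2 * r ^ 2 * t))
      rw [hfr]
      gcongr
      have h1 : p * S1 ^ 2 ≤ (a * S1 * E1) ^ 2 / 2 := by
        have := mul_le_mul_of_nonneg_left hE1 (by positivity : 0 ≤ a ^ 2 / 2 * S1 ^ 2)
        rw [hp]
        linarith
      have h2 : (b * S2 * E2) ^ 2 ≤ q * S2 ^ 2 := by
        have := mul_le_mul_of_nonneg_left hE2 (by positivity : 0 ≤ b ^ 2 * S2 ^ 2)
        linarith
      nlinarith [sq_nonneg (a * S1 * E1 - 2 * (b * S2 * E2))])
  rw [intervalIntegral.integral_of_le hR] at hbound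
  have hmono : ∫ r in Set.Ioc (1 / t) (δ / √t), f r ≤ ∫ r in Set.Ioc 0 ε0, f r := by
    refine setIntegral_mono_set hint ?_
      (Filter.Eventually.of_forall (Set.Ioc_subset_Ioc ht'.le hRε))
    refine (ae_restrict_iff' measurableSet_Ioc).2 (Filter.Eventually.of_forall fun r hr => ?_)
    exact mul_nonneg (sq_nonneg _) hr.1.le
  refine le_trans ?_ (hbound.trans hmono)
  rw [hRt, Real.log_mul hδ0.ne' hs0.ne', Real.log_sqrt ht0.le]
  rw [div_le_iff₀ (by positivity)] at hlog
  linarith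

theorem ddw_lower_bound_critical_dim (σ n : ℕ) (hn : n = 2 + 2 * σ)
    (ℓ1 ℓ2 β1 β2 c1 c2 ε0 : ℝ) (hℓ1 : ℓ1 ≠ 0) (hℓ2 : ℓ2 ≠ 0)
    (hβ1 : 0 < β1) (hβ2 : 0 < β2) (hc1 : 0 < c1) (hc2 : 0 < c2)
    (hc : c1 ≠ c2) (hε0 : 0 < ε0)
    (hcond : ℓ1 ^ 2 * β2 ^ 2 > 2 * ℓ2 ^ 2 * β1 ^ 2
      ∨ ℓ2 ^ 2 * β1 ^ 2 > 2 * ℓ1 ^ 2 * β2 ^ 2) :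
    ∃ c > 0, ∃ T > 1, ∀ t ≥ T,
      c * Real.log t ≤ ddwIntegral ℓ1 ℓ2 β1 β2 c1 c2 ε0 σ n t := by
  rcases hcond with h | h
  · exact ddwIntegral_lower_bound_of_gt σ n hn ℓ1 ℓ2 β1 β2 c1 c2 ε0 hβ1 hβ2 hc1 hc2 hε0 h
  · simp only [ddwIntegral_swap ℓ1 ℓ2]
    exact ddwIntegral_lower_bound_of_gt σ n hn ℓ2 ℓ1 β2 β1 c2 c1 ε0 hβ2 hβ1 hc2 hc1 hε0 h
end

section
/- Let σ ≥ 0 be an integer and let n be an integer with n ≥ 3 + 2σ. Let ℓ1, ℓ2 be nonzero reals and β1, β2, c1, c2, ε0 > 0 with c1 ≠ c2. Then there exist constants c > 0 and T > 0 such that I(t;n) ≥ c·t^{1+σ−n/2} for all t ≥ T. -/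
open MeasureTheory Real

/-- When `n = 3 + 2σ + p`, the singular factor `r⁻²` cancels against the weight. -/
lemma ddwIntegral_eq_integral_pow (ℓ1 ℓ2 β1 β2 c1 c2 ε0 : ℝ) (σ p : ℕ) (t : ℝ) :
    ddwIntegral ℓ1 ℓ2 β1 β2 c1 c2 ε0 σ (3 + 2 * σ + p) t =
      ∫ r in Set.Ioc (0 : ℝ) ε0,
        (ℓ1 / β1 * sin (β1 * r * t) * exp (-(c1 * r ^ 2 * t))
          - ℓ2 / β2 * sin (β2 * r * t) * exp (-(c2 * r ^ 2 * t))) ^ 2 * r ^ p := by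
  refine setIntegral_congr_fun measurableSet_Ioc fun r hr => ?_
  have hr0 : r ≠ 0 := hr.1.ne'
  have hexp : ((3 + 2 * σ + p : ℕ) : ℝ) - 1 - 2 * (σ : ℝ) = ((2 + p : ℕ) : ℝ) := by
    push_cast; ring
  simp only [sq_abs]
  rw [hexp, rpow_natCast, pow_add, ← mul_assoc, ← mul_pow]
  congr 2
  rw [sub_mul]
  congr 1
  · rw [← div_div]; field_simp
  · rw [← div_div]; field_simp

lemma exists_exp_neg_mul_le (B : ℝ) {d δ : ℝ} (hd : 0 < d) (hδ : 0 < δ) :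
    ∃ a : ℝ, 0 < a ∧ ∀ u, a ^ 2 ≤ u → B * exp (-(d * u)) ≤ δ := by
  have hlim : Filter.Tendsto (fun u : ℝ => B * exp (-(d * u))) Filter.atTop (nhds 0) := by
    have h := (tendsto_exp_neg_atTop_nhds_zero.comp
      (Filter.tendsto_id.const_mul_atTop hd)).const_mul B
    simpa [Function.comp_def] using h
  obtain ⟨U, hU⟩ := Filter.eventually_atTop.1 (hlim.eventually_le_const hδ)
  refine ⟨max U 1, by positivity, fun u hu => hU u ?_⟩
  nlinarith [le_max_left U 1, le_max_right U 1]

lemma mul_half_sq_sub_le_sq_sub {A E S y : ℝ} (hy : y ^ 2 ≤ A ^ 2 * E ^ 2 / 8) :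
    A ^ 2 * E ^ 2 * (S ^ 2 / 2 - 1 / 8) ≤ (A * S * E - y) ^ 2 := by
  nlinarith [sq_nonneg (A * S * E - 2 * y)]

lemma integral_half_sin_sq_sub (b x y : ℝ) (hb : b ≠ 0) :
    ∫ r in x..y, (sin (b * r) ^ 2 / 2 - 1 / 8) =
      (y - x) / 8 - (sin (2 * b * y) - sin (2 * b * x)) / (8 * b) := by
  have hderiv : ∀ r ∈ Set.uIcc x y,
      HasDerivAt (fun r : ℝ => r / 8 - sin (2 * b * r) / (8 * b))
        (sin (b * r) ^ 2 / 2 - 1 / 8) r := by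
    intro r _
    have h1 : HasDerivAt (fun r : ℝ => 2 * b * r) (2 * b) r := by
      simpa using (hasDerivAt_id r).const_mul (2 * b)
    refine (((hasDerivAt_id r).div_const 8).sub (h1.sin.div_const (8 * b))).congr_deriv ?_
    rw [mul_assoc 2 b r, cos_two_mul, cos_sq']
    field_simp
    ring
  rw [intervalIntegral.integral_eq_sub_of_hasDerivAt hderiv
    (Continuous.intervalIntegrable (by fun_prop) _ _)]
  ring

lemma div_sixteen_le_integral {β a τ : ℝ} (hβ : 0 < β) (hτ : 0 < τ) (hβτ : 4 / β ≤ τ) :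
    1 / (16 * τ) ≤ ∫ r in (a / τ)..((a + 1) / τ), (sin (β * r * τ ^ 2) ^ 2 / 2 - 1 / 8) := by
  have hb : 0 < β * τ ^ 2 := by positivity
  have hcomm : ∀ r : ℝ, β * r * τ ^ 2 = β * τ ^ 2 * r := fun r => by ring
  simp only [hcomm]
  rw [integral_half_sin_sq_sub _ _ _ hb.ne']
  set s := sin (2 * (β * τ ^ 2) * ((a + 1) / τ)) - sin (2 * (β * τ ^ 2) * (a / τ)) with hs
  have hs2 : s ≤ 2 := by
    rw [hs]
    linarith [sin_le_one (2 * (β * τ ^ 2) * ((a + 1) / τ)),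
      neg_one_le_sin (2 * (β * τ ^ 2) * (a / τ))]
  have hτ4 : 4 ≤ β * τ := by
    rwa [div_le_iff₀ hβ, mul_comm] at hβτ
  have hlen : ((a + 1) / τ - a / τ) / 8 = 1 / (8 * τ) := by field_simp; ring
  have hbound : s / (8 * (β * τ ^ 2)) ≤ 1 / (16 * τ) := by
    rw [div_le_div_iff₀ (by positivity) (by positivity)]
    nlinarith
  have hhalf : 1 / (8 * τ) = 1 / (16 * τ) + 1 / (16 * τ) := by field_simp; norm_num
  linarith

lemma ddw_integrand_lower_bound {A B β1 β2 c1 c2 a τ r : ℝ} (p : ℕ)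
    (hc1 : 0 < c1) (ha : 0 < a) (hτ : 0 < τ)
    (hB : ∀ u, a ^ 2 ≤ u → B ^ 2 * exp (-(2 * (c2 - c1) * u)) ≤ A ^ 2 / 8)
    (hr : a / τ ≤ r) (hr' : r ≤ (a + 1) / τ) :
    A ^ 2 * exp (-(2 * c1 * (a + 1) ^ 2)) * (a / τ) ^ p *
        (sin (β1 * r * τ ^ 2) ^ 2 / 2 - 1 / 8) ≤
      (A * sin (β1 * r * τ ^ 2) * exp (-(c1 * r ^ 2 * τ ^ 2))
        - B * sin (β2 * r * τ ^ 2) * exp (-(c2 * r ^ 2 * τ ^ 2))) ^ 2 * r ^ p := by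
  have haτ : 0 < a / τ := by positivity
  have hr0 : 0 < r := haτ.trans_le hr
  set q := sin (β1 * r * τ ^ 2) ^ 2 / 2 - 1 / 8 with hq
  rcases le_or_gt q 0 with hq0 | hq0
  · exact (mul_nonpos_of_nonneg_of_nonpos (by positivity) hq0).trans (by positivity)
  have hlow : a ≤ r * τ := (div_le_iff₀ hτ).1 hr
  have hupp : r * τ ≤ a + 1 := (le_div_iff₀ hτ).1 hr'
  have hexp_sq : ∀ c : ℝ, exp (-(c * r ^ 2 * τ ^ 2)) ^ 2 = exp (-(2 * c * (r * τ) ^ 2)) := by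
    intro c
    rw [← exp_nat_mul]
    congr 1
    push_cast; ring
  have hy : (B * sin (β2 * r * τ ^ 2) * exp (-(c2 * r ^ 2 * τ ^ 2))) ^ 2 ≤
      A ^ 2 * exp (-(c1 * r ^ 2 * τ ^ 2)) ^ 2 / 8 := by
    rw [mul_pow, mul_pow, hexp_sq, hexp_sq]
    have hsplit : exp (-(2 * c2 * (r * τ) ^ 2)) =
        exp (-(2 * (c2 - c1) * (r * τ) ^ 2)) * exp (-(2 * c1 * (r * τ) ^ 2)) := by
      rw [← exp_add]; congr 1; ring
    calc B ^ 2 * sin (β2 * r * τ ^ 2) ^ 2 * exp (-(2 * c2 * (r * τ) ^ 2))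
        ≤ B ^ 2 * 1 * exp (-(2 * c2 * (r * τ) ^ 2)) := by
          gcongr; exact sin_sq_le_one _
      _ = B ^ 2 * exp (-(2 * (c2 - c1) * (r * τ) ^ 2)) * exp (-(2 * c1 * (r * τ) ^ 2)) := by
          rw [hsplit]; ring
      _ ≤ A ^ 2 / 8 * exp (-(2 * c1 * (r * τ) ^ 2)) := by
          gcongr
          exact hB _ (by gcongr)
      _ = A ^ 2 * exp (-(2 * c1 * (r * τ) ^ 2)) / 8 := by ring
  calc A ^ 2 * exp (-(2 * c1 * (a + 1) ^ 2)) * (a / τ) ^ p * q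
      ≤ A ^ 2 * exp (-(2 * c1 * (r * τ) ^ 2)) * r ^ p * q := by gcongr
    _ = A ^ 2 * exp (-(c1 * r ^ 2 * τ ^ 2)) ^ 2 * q * r ^ p := by rw [hexp_sq]; ring
    _ ≤ _ := by
      gcongr
      exact mul_half_sq_sub_le_sq_sub hy

lemma ddw_lower_bound_of_lt (σ p : ℕ) (ℓ1 ℓ2 β1 β2 c1 c2 ε0 : ℝ) (hℓ1 : ℓ1 ≠ 0)
    (hβ1 : 0 < β1) (hc1 : 0 < c1) (hc : c1 < c2) (hε0 : 0 < ε0) :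
    ∃ c > 0, ∃ T > 0, ∀ t ≥ T,
      c * t ^ (1 + (σ : ℝ) - ((3 + 2 * σ + p : ℕ) : ℝ) / 2)
        ≤ ddwIntegral ℓ1 ℓ2 β1 β2 c1 c2 ε0 σ (3 + 2 * σ + p) t := by
  set A := ℓ1 / β1 with hA
  set B := ℓ2 / β2 with hB
  have hA0 : A ≠ 0 := div_ne_zero hℓ1 hβ1.ne'
  obtain ⟨a, ha, hdecay⟩ := exists_exp_neg_mul_le (B ^ 2) (d := 2 * (c2 - c1))
    (δ := A ^ 2 / 8) (by linarith) (by positivity)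
  set K := A ^ 2 * exp (-(2 * c1 * (a + 1) ^ 2)) with hK
  have hKpos : 0 < K := by positivity
  refine ⟨K * a ^ p / 16, by positivity, (4 / β1 + (a + 1) / ε0) ^ 2, by positivity, ?_⟩
  intro t ht
  have ht0 : 0 < t := lt_of_lt_of_le (by positivity) ht
  obtain ⟨τ, hτ, rfl⟩ : ∃ τ : ℝ, 0 < τ ∧ τ ^ 2 = t :=
    ⟨√t, sqrt_pos.2 ht0, sq_sqrt ht0.le⟩
  have hτT : 4 / β1 + (a + 1) / ε0 ≤ τ := le_of_sq_le_sq ht hτ.le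
  have hτ1 : 4 / β1 ≤ τ := by
    have : 0 < (a + 1) / ε0 := by positivity
    linarith
  have hτ2 : (a + 1) / τ ≤ ε0 := by
    have : 0 < 4 / β1 := by positivity
    exact (div_le_comm₀ hε0 hτ).1 (by linarith)
  have hpow : (τ ^ 2) ^ (1 + (σ : ℝ) - ((3 + 2 * σ + p : ℕ) : ℝ) / 2) = (τ ^ (p + 1))⁻¹ := by
    rw [← rpow_natCast τ 2, ← rpow_mul hτ.le, ← rpow_natCast τ (p + 1), ← rpow_neg hτ.le]
    congr 1
    push_cast; ring
  rw [hpow, ddwIntegral_eq_integral_pow, ← hA, ← hB]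
  set g : ℝ → ℝ := fun r =>
    (A * sin (β1 * r * τ ^ 2) * exp (-(c1 * r ^ 2 * τ ^ 2))
      - B * sin (β2 * r * τ ^ 2) * exp (-(c2 * r ^ 2 * τ ^ 2))) ^ 2 * r ^ p with hg
  have hgcont : Continuous g := by fun_prop
  have hle : a / τ ≤ (a + 1) / τ := by gcongr; linarith
  have hsub : Set.Ioc (a / τ) ((a + 1) / τ) ⊆ Set.Ioc 0 ε0 :=
    Set.Ioc_subset_Ioc (by positivity) hτ2
  calc K * a ^ p / 16 * (τ ^ (p + 1))⁻¹
      = K * (a / τ) ^ p * (1 / (16 * τ)) := by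
        rw [div_pow, pow_succ]; field_simp
    _ ≤ K * (a / τ) ^ p *
          ∫ r in (a / τ)..((a + 1) / τ), (sin (β1 * r * τ ^ 2) ^ 2 / 2 - 1 / 8) := by
        gcongr
        exact div_sixteen_le_integral hβ1 hτ hτ1
    _ = ∫ r in (a / τ)..((a + 1) / τ),
          K * (a / τ) ^ p * (sin (β1 * r * τ ^ 2) ^ 2 / 2 - 1 / 8) :=
        (intervalIntegral.integral_const_mul _ _).symm
    _ ≤ ∫ r in (a / τ)..((a + 1) / τ), g r := by
        refine intervalIntegral.integral_mono_on hle
          (Continuous.intervalIntegrable (by fun_prop) _ _)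
          (hgcont.intervalIntegrable _ _) fun r hr => ?_
        exact ddw_integrand_lower_bound p hc1 ha hτ hdecay hr.1 hr.2
    _ = ∫ r in Set.Ioc (a / τ) ((a + 1) / τ), g r := intervalIntegral.integral_of_le hle
    _ ≤ ∫ r in Set.Ioc 0 ε0, g r := by
        refine setIntegral_mono_set hgcont.integrableOn_Ioc ?_ hsub.eventuallyLE
        filter_upwards [ae_restrict_mem measurableSet_Ioc] with r hr
        exact mul_nonneg (sq_nonneg _) (pow_nonneg hr.1.le p)

theorem ddw_lower_bound_high_dim (σ n : ℕ) (hn : 3 + 2 * σ ≤ n)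
    (ℓ1 ℓ2 β1 β2 c1 c2 ε0 : ℝ) (hℓ1 : ℓ1 ≠ 0) (hℓ2 : ℓ2 ≠ 0)
    (hβ1 : 0 < β1) (hβ2 : 0 < β2) (hc1 : 0 < c1) (hc2 : 0 < c2)
    (hc : c1 ≠ c2) (hε0 : 0 < ε0) :
    ∃ c > 0, ∃ T > 0, ∀ t ≥ T,
      c * t ^ (1 + (σ : ℝ) - (n : ℝ) / 2)
        ≤ ddwIntegral ℓ1 ℓ2 β1 β2 c1 c2 ε0 σ n t := by
  obtain ⟨p, rfl⟩ := Nat.exists_eq_add_of_le hn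
  rcases lt_or_gt_of_ne hc with h | h
  · exact ddw_lower_bound_of_lt σ p ℓ1 ℓ2 β1 β2 c1 c2 ε0 hℓ1 hβ1 hc1 h hε0
  · simp only [ddwIntegral_swap ℓ1 ℓ2]
    exact ddw_lower_bound_of_lt σ p ℓ2 ℓ1 β2 β1 c2 c1 ε0 hℓ2 hβ2 hc2 h hε0
end

section
/- Let σ = 1 and n ∈ {1,2}. Let ℓ1 = ℓ2 be nonzero reals, β1 = β2 > 0, and c1, c2 > 0 with c1 ≠ c2. Then: (i) there exists C > 0 such that I(t;n) ≤ C·(1+t)^{2−n/2} for all t > 0; and (ii) there exist c > 0 and T > 0 such that I(t;n) ≥ c·t^{2−n/2} for all t ≥ T. -/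
open MeasureTheory Real

lemma sub_mul_exp_neg_le_exp_neg_sub (a b : ℝ) : (b - a) * exp (-b) ≤ exp (-a) - exp (-b) := by
  have h : exp (-a) = exp (b - a) * exp (-b) := by rw [← exp_add]; ring_nf
  nlinarith [add_one_le_exp (b - a), exp_pos (-b)]

lemma exp_neg_sub_le_sub_mul_exp_neg (a b : ℝ) : exp (-a) - exp (-b) ≤ (b - a) * exp (-a) := by
  linarith [sub_mul_exp_neg_le_exp_neg_sub b a]

/-- The integrand of `ddwIntegral` with `σ = 1` and equal amplitudes and speeds, in factored
form. -/
noncomputable def ddwIntegrand (ℓ β c1 c2 : ℝ) (n : ℕ) (t r : ℝ) : ℝ :=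
  (ℓ / β) ^ 2 * sin (β * r * t) ^ 2 * (exp (-(c1 * r ^ 2 * t)) - exp (-(c2 * r ^ 2 * t))) ^ 2
    * r ^ ((n : ℝ) - 5)

lemma ddwIntegral_eq_integral_ddwIntegrand (ℓ β c1 c2 ε0 : ℝ) (n : ℕ) (t : ℝ) :
    ddwIntegral ℓ ℓ β β c1 c2 ε0 1 n t
      = ∫ r in Set.Ioc (0 : ℝ) ε0, ddwIntegrand ℓ β c1 c2 n t r := by
  refine setIntegral_congr_fun measurableSet_Ioc fun r hr => ?_
  have h : r ^ ((n : ℝ) - 1 - 2 * ((1 : ℕ) : ℝ)) = r ^ ((n : ℝ) - 5) * r ^ 2 := by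
    rw [← rpow_natCast r 2, ← rpow_add hr.1]
    norm_num
    ring_nf
  have hr0 : r ≠ 0 := hr.1.ne'
  simp only [ddwIntegrand, sq_abs, h]
  by_cases hβ : β = 0
  · simp [hβ]
  · field_simp

lemma ddwIntegral_comm (ℓ β c1 c2 ε0 : ℝ) (n : ℕ) (t : ℝ) :
    ddwIntegral ℓ ℓ β β c1 c2 ε0 1 n t = ddwIntegral ℓ ℓ β β c2 c1 ε0 1 n t := by
  simp only [ddwIntegral_eq_integral_ddwIntegrand, ddwIntegrand, sub_sq_comm]

lemma ddwIntegrand_nonneg (ℓ β c1 c2 : ℝ) (n : ℕ) (t : ℝ) {r : ℝ} (hr : 0 < r) :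
    0 ≤ ddwIntegrand ℓ β c1 c2 n t r := by
  unfold ddwIntegrand; positivity

lemma ddwIntegrand_le (ℓ β : ℝ) {c1 c2 : ℝ} (hc : c1 < c2) (n : ℕ) {t r : ℝ} (ht : 0 < t)
    (hr : 0 < r) :
    ddwIntegrand ℓ β c1 c2 n t r ≤
      (ℓ / β) ^ 2 * (c2 - c1) ^ 2 * t ^ 2
        * (r ^ ((n : ℝ) - 1) * exp (-(2 * c1 * t) * r ^ (2 : ℝ))) := by
  have hle : c1 * r ^ 2 * t ≤ c2 * r ^ 2 * t := by gcongr
  have hexp : (exp (-(c1 * r ^ 2 * t)) - exp (-(c2 * r ^ 2 * t))) ^ 2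
      ≤ ((c2 * r ^ 2 * t - c1 * r ^ 2 * t) * exp (-(c1 * r ^ 2 * t))) ^ 2 :=
    pow_le_pow_left₀ (sub_nonneg.2 (exp_le_exp.2 (neg_le_neg hle)))
      (exp_neg_sub_le_sub_mul_exp_neg _ _) 2
  have hpow : r ^ ((n : ℝ) - 1) = r ^ ((n : ℝ) - 5) * r ^ 4 := by
    rw [← rpow_natCast r 4, ← rpow_add hr]
    norm_num
    ring_nf
  have hsq : exp (-(2 * c1 * t) * r ^ (2 : ℝ)) = exp (-(c1 * r ^ 2 * t)) ^ 2 := by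
    rw [← exp_nat_mul, rpow_two]
    push_cast
    ring_nf
  calc ddwIntegrand ℓ β c1 c2 n t r
      ≤ (ℓ / β) ^ 2 * 1
          * ((c2 * r ^ 2 * t - c1 * r ^ 2 * t) * exp (-(c1 * r ^ 2 * t))) ^ 2
          * r ^ ((n : ℝ) - 5) := by
        unfold ddwIntegrand
        gcongr
        exact sin_sq_le_one _
    _ = _ := by rw [hpow, hsq]; ring

lemma integrableOn_rpow_sub_one_mul_exp_neg_mul_sq {n : ℕ} (hn : 1 ≤ n) {b : ℝ} (hb : 0 < b) :
    IntegrableOn (fun r : ℝ => r ^ ((n : ℝ) - 1) * exp (-b * r ^ (2 : ℝ))) (Set.Ioi 0) := by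
  have hn' : (1 : ℝ) ≤ n := by exact_mod_cast hn
  exact integrableOn_rpow_mul_exp_neg_mul_rpow (by linarith) (by norm_num) hb

lemma integrableOn_ddwIntegrand (ℓ β : ℝ) {c1 c2 : ℝ} (hc1 : 0 < c1) (hc : c1 < c2) {n : ℕ}
    (hn : 1 ≤ n) {t : ℝ} (ht : 0 < t) :
    IntegrableOn (ddwIntegrand ℓ β c1 c2 n t) (Set.Ioi 0) := by
  refine Integrable.mono' ((integrableOn_rpow_sub_one_mul_exp_neg_mul_sq hn
    (show 0 < 2 * c1 * t by positivity)).const_mul ((ℓ / β) ^ 2 * (c2 - c1) ^ 2 * t ^ 2)) ?_ ?_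
  · have : Measurable (ddwIntegrand ℓ β c1 c2 n t) := by
      unfold ddwIntegrand; fun_prop
    exact this.aestronglyMeasurable
  · filter_upwards [ae_restrict_mem measurableSet_Ioi] with r hr
    rw [norm_of_nonneg (ddwIntegrand_nonneg ℓ β c1 c2 n t hr)]
    exact ddwIntegrand_le ℓ β hc n ht hr

lemma exists_ddwIntegral_le {ℓ β c1 c2 : ℝ} (ε0 : ℝ) (hℓ : ℓ ≠ 0) (hβ : 0 < β)
    (hc1 : 0 < c1) (hc : c1 < c2) {n : ℕ} (hn : 1 ≤ n) :
    ∃ C > 0, ∀ t > 0,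
      ddwIntegral ℓ ℓ β β c1 c2 ε0 1 n t ≤ C * t ^ ((2 : ℝ) - (n : ℝ) / 2) := by
  have hn' : (1 : ℝ) ≤ n := by exact_mod_cast hn
  have hd : 0 < c2 - c1 := sub_pos.2 hc
  have hΓ : 0 < Gamma ((n : ℝ) / 2) := Gamma_pos_of_pos (by positivity)
  refine ⟨(ℓ / β) ^ 2 * (c2 - c1) ^ 2
    * ((2 * c1) ^ (-((n : ℝ) / 2)) * (1 / 2) * Gamma ((n : ℝ) / 2)), by positivity,
    fun t ht => ?_⟩
  have hb : 0 < 2 * c1 * t := by positivity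
  calc ddwIntegral ℓ ℓ β β c1 c2 ε0 1 n t
      = ∫ r in Set.Ioc (0 : ℝ) ε0, ddwIntegrand ℓ β c1 c2 n t r :=
        ddwIntegral_eq_integral_ddwIntegrand ..
    _ ≤ ∫ r in Set.Ioi (0 : ℝ), ddwIntegrand ℓ β c1 c2 n t r := by
        refine setIntegral_mono_set (integrableOn_ddwIntegrand ℓ β hc1 hc hn ht) ?_
          Set.Ioc_subset_Ioi_self.eventuallyLE
        filter_upwards [ae_restrict_mem measurableSet_Ioi] with r hr
        exact ddwIntegrand_nonneg ℓ β c1 c2 n t hr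
    _ ≤ ∫ r in Set.Ioi (0 : ℝ), (ℓ / β) ^ 2 * (c2 - c1) ^ 2 * t ^ 2
          * (r ^ ((n : ℝ) - 1) * exp (-(2 * c1 * t) * r ^ (2 : ℝ))) :=
        setIntegral_mono_on (integrableOn_ddwIntegrand ℓ β hc1 hc hn ht)
          ((integrableOn_rpow_sub_one_mul_exp_neg_mul_sq hn hb).const_mul _) measurableSet_Ioi
          fun r hr => ddwIntegrand_le ℓ β hc n ht hr
    _ = _ := by
        have he : ((n : ℝ) - 1 + 1) / 2 = n / 2 := by ring
        have he' : -((n : ℝ) - 1 + 1) / 2 = -(n / 2) := by ring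
        rw [integral_const_mul, integral_rpow_mul_exp_neg_mul_rpow (by norm_num) (by linarith) hb,
          he, he', mul_rpow (by positivity) ht.le, sub_eq_add_neg (2 : ℝ), rpow_add ht, rpow_two]
        ring

lemma le_ddwIntegrand (ℓ β : ℝ) {c1 c2 : ℝ} (hc2 : 0 < c2) (hc : c1 < c2) {n : ℕ}
    (hn : n ≤ 5) {t r : ℝ} (ht : 0 < t) (hr : 1 / √t ≤ r) (hr' : r ≤ 2 / √t) :
    (ℓ / β) ^ 2 * ((c2 - c1) * exp (-(4 * c2))) ^ 2 * (2 / √t) ^ ((n : ℝ) - 5)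
      * sin (β * t * r) ^ 2 ≤ ddwIntegrand ℓ β c1 c2 n t r := by
  have hs : 0 < √t := sqrt_pos.2 ht
  have hr0 : 0 < r := lt_of_lt_of_le (by positivity) hr
  have hd : 0 < c2 - c1 := sub_pos.2 hc
  rw [div_le_iff₀ hs] at hr
  have hr'' := (le_div_iff₀ hs).1 hr'
  have hrt : r ^ 2 * t = (r * √t) ^ 2 := by rw [mul_pow, sq_sqrt ht.le]
  have h1 : 1 ≤ r ^ 2 * t := by rw [hrt]; nlinarith
  have h4 : r ^ 2 * t ≤ 4 := by rw [hrt]; nlinarith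
  have hexp : (c2 - c1) * exp (-(4 * c2))
      ≤ exp (-(c1 * r ^ 2 * t)) - exp (-(c2 * r ^ 2 * t)) := by
    refine le_trans ?_ (sub_mul_exp_neg_le_exp_neg_sub _ _)
    have hdiff : c2 - c1 ≤ c2 * r ^ 2 * t - c1 * r ^ 2 * t := by nlinarith
    have hmax : c2 * r ^ 2 * t ≤ 4 * c2 := by nlinarith
    exact mul_le_mul hdiff (exp_le_exp.2 (neg_le_neg hmax)) (exp_pos _).le (hd.le.trans hdiff)
  have hpow : (2 / √t) ^ ((n : ℝ) - 5) ≤ r ^ ((n : ℝ) - 5) :=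
    rpow_le_rpow_of_nonpos hr0 hr' (sub_nonpos.2 (by exact_mod_cast hn))
  calc _ = (ℓ / β) ^ 2 * sin (β * r * t) ^ 2 * ((c2 - c1) * exp (-(4 * c2))) ^ 2
        * (2 / √t) ^ ((n : ℝ) - 5) := by rw [mul_right_comm β t r]; ring
    _ ≤ _ := by unfold ddwIntegrand; gcongr

lemma half_sub_sub_inv_le_integral_sin_mul_sq {w : ℝ} (hw : 0 < w) (a b : ℝ) :
    (b - a) / 2 - w⁻¹ ≤ ∫ r in a..b, sin (w * r) ^ 2 := by
  rw [intervalIntegral.integral_comp_mul_left (fun x => sin x ^ 2) hw.ne', integral_sin_sq,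
    smul_eq_mul]
  have h : ∀ x, |sin x * cos x| ≤ 1 := fun x => by
    rw [abs_mul]
    exact mul_le_one₀ (abs_sin_le_one x) (abs_nonneg _) (abs_cos_le_one x)
  have key : w * (b - a) / 2 - 1
      ≤ (sin (w * a) * cos (w * a) - sin (w * b) * cos (w * b) + w * b - w * a) / 2 := by
    linarith [(abs_le.1 (h (w * a))).1, (abs_le.1 (h (w * b))).2]
  calc (b - a) / 2 - w⁻¹ = w⁻¹ * (w * (b - a) / 2 - 1) := by field_simp
    _ ≤ _ := by gcongr

lemma exists_le_ddwIntegral {ℓ β c1 c2 ε0 : ℝ} (hℓ : ℓ ≠ 0) (hβ : 0 < β)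
    (hc1 : 0 < c1) (hc : c1 < c2) (hε0 : 0 < ε0) {n : ℕ} (hn : 1 ≤ n) (hn5 : n ≤ 5) :
    ∃ c > 0, ∃ T > 0, ∀ t ≥ T,
      c * t ^ ((2 : ℝ) - (n : ℝ) / 2) ≤ ddwIntegral ℓ ℓ β β c1 c2 ε0 1 n t := by
  have hd : 0 < c2 - c1 := sub_pos.2 hc
  set K := (ℓ / β) ^ 2 * ((c2 - c1) * exp (-(4 * c2))) ^ 2 with hK
  have hKpos : 0 < K := by positivity
  refine ⟨K * 2 ^ ((n : ℝ) - 5) / 4, by positivity, (2 / ε0 + 4 / β) ^ 2, by positivity,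
    fun t hT => ?_⟩
  have ht : 0 < t := lt_of_lt_of_le (by positivity) hT
  have hs : 0 < √t := sqrt_pos.2 ht
  have hsT : 2 / ε0 + 4 / β ≤ √t := le_sqrt_of_sq_le hT
  have hsε : 2 / √t ≤ ε0 := by
    have : 2 / ε0 ≤ √t := le_trans (by linarith [show 0 < 4 / β by positivity]) hsT
    rw [div_le_iff₀ hε0] at this
    rw [div_le_iff₀ hs]
    linarith
  have hsβ : (β * t)⁻¹ ≤ 1 / (4 * √t) := by
    have : 4 / β ≤ √t := le_trans (by linarith [show 0 < 2 / ε0 by positivity]) hsT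
    rw [div_le_iff₀ hβ] at this
    rw [inv_eq_one_div]
    refine one_div_le_one_div_of_le (by positivity) ?_
    nlinarith [mul_self_sqrt ht.le]
  have hle : 1 / √t ≤ 2 / √t := by gcongr; norm_num
  have hsub : Set.Ioc (1 / √t) (2 / √t) ⊆ Set.Ioc 0 ε0 :=
    Set.Ioc_subset_Ioc (by positivity) hsε
  have hf_int : IntegrableOn (ddwIntegrand ℓ β c1 c2 n t) (Set.Ioc 0 ε0) :=
    (integrableOn_ddwIntegrand ℓ β hc1 hc hn ht).mono_set Set.Ioc_subset_Ioi_self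
  have hpow : t ^ ((2 : ℝ) - (n : ℝ) / 2) = (√t) ^ (-((n : ℝ) - 5)) * (1 / √t) := by
    rw [one_div, ← rpow_neg_one (√t), ← rpow_add hs, sqrt_eq_rpow, ← rpow_mul ht.le]
    ring_nf
  calc K * 2 ^ ((n : ℝ) - 5) / 4 * t ^ ((2 : ℝ) - (n : ℝ) / 2)
      = K * (2 / √t) ^ ((n : ℝ) - 5) * (1 / (4 * √t)) := by
        rw [hpow, div_rpow (by norm_num) hs.le, rpow_neg hs.le]
        field_simp
    _ ≤ K * (2 / √t) ^ ((n : ℝ) - 5) * ∫ r in (1 / √t)..(2 / √t), sin (β * t * r) ^ 2 := by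
        refine mul_le_mul_of_nonneg_left (le_trans ?_
          (half_sub_sub_inv_le_integral_sin_mul_sq (by positivity) _ _)) (by positivity)
        have : (2 / √t - 1 / √t) / 2 = 1 / (4 * √t) + 1 / (4 * √t) := by
          field_simp; norm_num
        linarith
    _ = ∫ r in Set.Ioc (1 / √t) (2 / √t),
          K * (2 / √t) ^ ((n : ℝ) - 5) * sin (β * t * r) ^ 2 := by
        rw [intervalIntegral.integral_of_le hle, integral_const_mul]
    _ ≤ ∫ r in Set.Ioc (1 / √t) (2 / √t), ddwIntegrand ℓ β c1 c2 n t r := by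
        refine setIntegral_mono_on ?_ (hf_int.mono_set hsub) measurableSet_Ioc fun r hr =>
          le_ddwIntegrand ℓ β (hc1.trans hc) hc hn5 ht hr.1.le hr.2
        exact Continuous.integrableOn_Ioc (by fun_prop)
    _ ≤ ∫ r in Set.Ioc (0 : ℝ) ε0, ddwIntegrand ℓ β c1 c2 n t r := by
        refine setIntegral_mono_set hf_int ?_ hsub.eventuallyLE
        filter_upwards [ae_restrict_mem measurableSet_Ioc] with r hr
        exact ddwIntegrand_nonneg ℓ β c1 c2 n t hr.1
    _ = _ := (ddwIntegral_eq_integral_ddwIntegrand ..).symm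

theorem ddw_very_low_dim_equal_speeds (n : ℕ) (hn : n = 1 ∨ n = 2)
    (ℓ β c1 c2 ε0 : ℝ) (hℓ : ℓ ≠ 0) (hβ : 0 < β)
    (hc1 : 0 < c1) (hc2 : 0 < c2) (hc : c1 ≠ c2) (hε0 : 0 < ε0) :
    (∃ C > 0, ∀ t > 0,
        ddwIntegral ℓ ℓ β β c1 c2 ε0 1 n t ≤ C * (1 + t) ^ ((2 : ℝ) - (n : ℝ) / 2))
      ∧ (∃ c > 0, ∃ T > 0, ∀ t ≥ T,
        c * t ^ ((2 : ℝ) - (n : ℝ) / 2) ≤ ddwIntegral ℓ ℓ β β c1 c2 ε0 1 n t) := by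
  wlog hlt : c1 < c2 generalizing c1 c2
  · simp only [ddwIntegral_comm ℓ β c1 c2]
    exact this c2 c1 hc2 hc1 hc.symm (lt_of_le_of_ne (not_lt.1 hlt) hc.symm)
  have hn2 : (n : ℝ) ≤ 2 := by
    have : n ≤ 2 := by omega
    exact_mod_cast this
  refine ⟨?_, exists_le_ddwIntegral hℓ hβ hc1 hlt hε0 (by omega) (by omega)⟩
  obtain ⟨C, hC, h⟩ := exists_ddwIntegral_le ε0 hℓ hβ hc1 hlt (show 1 ≤ n by omega)
  refine ⟨C, hC, fun t ht => (h t ht).trans ?_⟩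
  gcongr
  · linarith
  · linarith
end

section
/- Let σ = 1 and n ∈ {1,2}. Let ℓ1, ℓ2 be nonzero reals with ℓ1 ≠ ℓ2, and let β1, β2, c1, c2, ε0 > 0 with c1 ≠ c2. Then for every t > 0 the double diffusion waves integral blows up: the nonnegative function r ↦ |ℓ1·(sin(β1 r t)/(β1 r))·exp(−c1 r² t) − ℓ2·(sin(β2 r t)/(β2 r))·exp(−c2 r² t)|² · r^{n−3} is not Lebesgue integrable on (0, ε0); equivalently, its Lebesgue integral over (0, ε0) equals +∞ (so I(t;n)|_{σ=1} = +∞ for all 0 < t ≤ t0 with any t0 > 0). -/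
open MeasureTheory Real

/-- A function with a positive limit at `0⁺`, times a nonintegrable power, is not integrable near
`0`. -/
theorem not_integrableOn_mul_rpow_of_tendsto_pos {g : ℝ → ℝ} {L p ε : ℝ}
    (hg : Filter.Tendsto g (nhdsWithin 0 (Set.Ioi 0)) (nhds L)) (hL : 0 < L) (hp : p ≤ -1)
    (hε : 0 < ε) : ¬ IntegrableOn (fun r ↦ g r * r ^ p) (Set.Ioc 0 ε) := by
  intro h
  obtain ⟨δ, hδ, hsub⟩ := mem_nhdsGT_iff_exists_Ioo_subset.1
    (hg.eventually (lt_mem_nhds (half_lt_self hL)))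
  have hm : 0 < min δ ε := lt_min hδ hε
  refine absurd ((intervalIntegral.integrableOn_Ioo_rpow_iff hm).1 ?_) (not_lt.2 hp)
  have hi : IntegrableOn (fun r ↦ 2 / L * (g r * r ^ p)) (Set.Ioo 0 (min δ ε)) :=
    (h.mono_set fun r hr ↦ ⟨hr.1, hr.2.le.trans (min_le_right _ _)⟩).const_mul _
  refine Integrable.mono' hi (by fun_prop) ?_
  filter_upwards [ae_restrict_mem measurableSet_Ioo] with r hr
  have hgr : L / 2 < g r := hsub ⟨hr.1, hr.2.trans_le (min_le_left _ _)⟩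
  have hr0 : 0 ≤ r ^ p := rpow_nonneg hr.1.le p
  rw [norm_of_nonneg hr0, ← mul_assoc]
  refine le_mul_of_one_le_left hr0 ?_
  rw [div_mul_eq_mul_div, one_le_div hL]
  linarith

/-- The Fourier multiplier of a diffusion wave tends to `ℓ * t` at zero frequency. -/
theorem tendsto_diffusion_wave_multiplier (ℓ c : ℝ) {β t : ℝ} (hβ : 0 < β) (ht : 0 < t) :
    Filter.Tendsto (fun r : ℝ ↦ ℓ * (sin (β * r * t) / (β * r)) * exp (-(c * r ^ 2 * t)))
      (nhdsWithin 0 (Set.Ioi 0)) (nhds (ℓ * t)) := by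
  have hcont : Continuous fun r : ℝ ↦ ℓ * (t * sinc (β * r * t)) * exp (-(c * r ^ 2 * t)) := by
    have := continuous_sinc
    fun_prop
  have hlim := (hcont.tendsto 0).mono_left (nhdsWithin_le_nhds (s := Set.Ioi 0))
  simp only [mul_zero, zero_mul, sinc_zero, mul_one, ne_eq, OfNat.ofNat_ne_zero,
    not_false_eq_true, zero_pow, neg_zero, exp_zero] at hlim
  refine hlim.congr' ?_
  filter_upwards [self_mem_nhdsWithin] with r hr
  have hr : 0 < r := hr
  rw [sinc_of_ne_zero (by positivity)]
  field_simp

theorem ddw_very_low_dim_blowup (n : ℕ) (hn : n = 1 ∨ n = 2)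
    (ℓ1 ℓ2 β1 β2 c1 c2 ε0 : ℝ) (hℓ1 : ℓ1 ≠ 0) (hℓ2 : ℓ2 ≠ 0) (hℓ : ℓ1 ≠ ℓ2)
    (hβ1 : 0 < β1) (hβ2 : 0 < β2) (hc1 : 0 < c1) (hc2 : 0 < c2)
    (hc : c1 ≠ c2) (hε0 : 0 < ε0) :
    ∀ t > 0,
      ¬ MeasureTheory.IntegrableOn
          (fun r : ℝ =>
            |ℓ1 * (Real.sin (β1 * r * t) / (β1 * r)) * Real.exp (-(c1 * r ^ 2 * t))
              - ℓ2 * (Real.sin (β2 * r * t) / (β2 * r)) * Real.exp (-(c2 * r ^ 2 * t))| ^ 2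
              * r ^ ((n : ℝ) - 3))
          (Set.Ioc (0 : ℝ) ε0)
      ∧ (∫⁻ r in Set.Ioc (0 : ℝ) ε0,
          ENNReal.ofReal
            (|ℓ1 * (Real.sin (β1 * r * t) / (β1 * r)) * Real.exp (-(c1 * r ^ 2 * t))
              - ℓ2 * (Real.sin (β2 * r * t) / (β2 * r)) * Real.exp (-(c2 * r ^ 2 * t))| ^ 2
              * r ^ ((n : ℝ) - 3))) = ⊤ := by
  intro t ht
  have hp : (n : ℝ) - 3 ≤ -1 := by
    rcases hn with rfl | rfl <;> norm_num
  have hL : 0 < |ℓ1 * t - ℓ2 * t| ^ 2 := by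
    rw [← sub_mul]
    exact pow_pos (abs_pos.2 (mul_ne_zero (sub_ne_zero.2 hℓ) ht.ne')) 2
  have hnot := not_integrableOn_mul_rpow_of_tendsto_pos
    (((tendsto_diffusion_wave_multiplier ℓ1 c1 hβ1 ht).sub
      (tendsto_diffusion_wave_multiplier ℓ2 c2 hβ2 ht)).abs.pow 2) hL hp hε0
  refine ⟨hnot, ?_⟩
  by_contra htop
  refine hnot ((lintegral_ofReal_ne_top_iff_integrable ?_ ?_).1 htop)
  · exact Measurable.aestronglyMeasurable (by fun_prop)
  · filter_upwards [ae_restrict_mem measurableSet_Ioc] with r hr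
    exact mul_nonneg (by positivity) (rpow_nonneg hr.1.le _)
end

section
/- Let n ≥ 1 be an integer and ε0 > 0, and let b, κ, γ, δ and the derived constants ν1, ν2, c1, c2 be as in the thermoelastic type III parameter setting. Define N(t) := ( ∫_{ξ ∈ ℝⁿ, |ξ| ≤ ε0} |cos(ν1|ξ|t)·exp(−c1|ξ|²t) − cos(ν2|ξ|t)·exp(−c2|ξ|²t)|² · |ξ|^{−2} dξ )^{1/2} for t > 0. Then N(t) = o(𝒟_n(1+t)) as t → ∞, i.e. N(t)/𝒟_n(1+t) → 0 as t → +∞. -/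
open MeasureTheory Real

/-- The rate function `𝒟ₙ(1+t)` from the paper. -/
noncomputable def Drate (n : ℕ) (t : ℝ) : ℝ :=
  if n = 1 ∨ n = 3 then (1 + t) ^ ((2 : ℝ) - (n : ℝ) / 2)
  else if n = 2 ∨ n = 4 then
    (1 + t) ^ ((2 : ℝ) - (n : ℝ) / 2) * Real.sqrt (Real.log (Real.exp 1 + t))
  else (1 + t) ^ ((1 : ℝ) - (n : ℝ) / 4)

/-- The rate function `ℰₙ(1+t)` from the paper. -/
noncomputable def Erate (n : ℕ) (t : ℝ) : ℝ :=
  if n = 1 then Real.sqrt (1 + t)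
  else if n = 2 then Real.sqrt (Real.log (Real.exp 1 + t))
  else (1 + t) ^ ((1 : ℝ) / 2 - (n : ℝ) / 4)

theorem sq_sub_sub_lt_discrim {b κ γ : ℝ} (hb : 0 < b) (hγ : γ ≠ 0) :
    (b ^ 2 - κ - γ ^ 2) ^ 2 < (b ^ 2 + κ + γ ^ 2) ^ 2 - 4 * b ^ 2 * κ := by
  have h : 0 < b ^ 2 * γ ^ 2 := by positivity
  nlinarith

/-- A damped cosine stays within a linear distance of its initial value `1`. -/
theorem abs_cos_mul_exp_sub_one_le (a : ℝ) {x : ℝ} (hx : 0 ≤ x) :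
    |cos a * exp (-x) - 1| ≤ |a| + x := by
  have h1 : |cos a - 1| ≤ |a| := by simpa using abs_cos_sub_cos_le a 0
  have h2 : |exp (-x) - 1| ≤ x := by
    rw [abs_sub_comm, abs_of_nonneg (by linarith [exp_le_one_iff.2 (neg_nonpos.2 hx)])]
    linarith [add_one_le_exp (-x)]
  have h3 : |cos a * (exp (-x) - 1)| ≤ x := by
    rw [abs_mul]
    nlinarith [abs_cos_le_one a, abs_nonneg (cos a), abs_nonneg (exp (-x) - 1)]
  calc |cos a * exp (-x) - 1| = |cos a * (exp (-x) - 1) + (cos a - 1)| := by ring_nf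
    _ ≤ x + |a| := (abs_add_le _ _).trans (add_le_add h3 h1)
    _ = |a| + x := add_comm _ _

/-- The square of the damped cosine kernel, weighted by `r ^ (-2)`. -/
noncomputable def weightedKernel (ν1 ν2 c1 c2 t r : ℝ) : ℝ :=
  |cos (ν1 * r * t) * exp (-(c1 * r ^ 2 * t)) - cos (ν2 * r * t) * exp (-(c2 * r ^ 2 * t))| ^ 2
    * r ^ (-2 : ℝ)

theorem weightedKernel_nonneg (ν1 ν2 c1 c2 t : ℝ) {r : ℝ} (hr : 0 ≤ r) :
    0 ≤ weightedKernel ν1 ν2 c1 c2 t r :=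
  mul_nonneg (by positivity) (rpow_nonneg hr _)

theorem weightedKernel_le_sq {c1 c2 t r R : ℝ} (ν1 ν2 : ℝ) (hc1 : 0 ≤ c1) (hc2 : 0 ≤ c2)
    (ht : 0 ≤ t) (hr : 0 ≤ r) (hrR : r ≤ R) :
    weightedKernel ν1 ν2 c1 c2 t r ≤ ((|ν1| + |ν2| + (c1 + c2) * R) * t) ^ 2 := by
  rcases hr.eq_or_lt with rfl | hr0
  · simp only [weightedKernel, mul_zero, zero_mul, cos_zero]
    norm_num
    positivity
  set K := |ν1| + |ν2| + (c1 + c2) * R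
  have h1 := abs_cos_mul_exp_sub_one_le (ν1 * r * t) (show 0 ≤ c1 * r ^ 2 * t by positivity)
  have h2 := abs_cos_mul_exp_sub_one_le (ν2 * r * t) (show 0 ≤ c2 * r ^ 2 * t by positivity)
  have h3 := abs_sub_le (cos (ν1 * r * t) * exp (-(c1 * r ^ 2 * t))) 1
    (cos (ν2 * r * t) * exp (-(c2 * r ^ 2 * t)))
  rw [abs_sub_comm 1] at h3
  rw [abs_mul, abs_mul, abs_of_nonneg hr, abs_of_nonneg ht] at h1 h2
  have h4 : (c1 + c2) * r * (r * t) ≤ (c1 + c2) * R * (r * t) := by gcongr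
  have h5 : |cos (ν1 * r * t) * exp (-(c1 * r ^ 2 * t))
      - cos (ν2 * r * t) * exp (-(c2 * r ^ 2 * t))| ≤ K * t * r := by
    simp only [K]
    nlinarith
  calc weightedKernel ν1 ν2 c1 c2 t r ≤ (K * t * r) ^ 2 * r ^ (-2 : ℝ) := by
        unfold weightedKernel
        gcongr
    _ = (K * t) ^ 2 := by
        rw [rpow_neg hr, rpow_two]
        field_simp

theorem weightedKernel_le_gaussian {c c1 c2 t r : ℝ} (ν1 ν2 : ℝ) (hc1 : c ≤ c1) (hc2 : c ≤ c2)
    (ht : 0 ≤ t) (hr : 0 ≤ r) :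
    weightedKernel ν1 ν2 c1 c2 t r ≤ 4 * (exp (-(2 * c) * (r ^ 2 * t)) * r ^ (-2 : ℝ)) := by
  have key : ∀ ν d : ℝ, c ≤ d →
      |cos (ν * r * t) * exp (-(d * r ^ 2 * t))| ≤ exp (-(c * r ^ 2 * t)) := by
    intro ν d hd
    rw [abs_mul, abs_of_pos (exp_pos _)]
    refine (mul_le_of_le_one_left (exp_pos _).le (abs_cos_le_one _)).trans ?_
    gcongr
  have h := (abs_sub _ _).trans (add_le_add (key ν1 c1 hc1) (key ν2 c2 hc2))
  have hexp : exp (-(2 * c) * (r ^ 2 * t)) = exp (-(c * r ^ 2 * t)) ^ 2 := by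
    rw [← exp_nat_mul]
    congr 1
    push_cast
    ring
  rw [← mul_assoc, hexp]
  unfold weightedKernel
  refine mul_le_mul_of_nonneg_right ?_ (rpow_nonneg hr _)
  calc _ ≤ (exp (-(c * r ^ 2 * t)) + exp (-(c * r ^ 2 * t))) ^ 2 := by gcongr
    _ = _ := by ring

theorem integrable_exp_neg_mul_sq_norm_mul_rpow {n : ℕ} (hn : 3 ≤ n) {c : ℝ} (hc : 0 < c) :
    Integrable fun ξ : EuclideanSpace ℝ (Fin n) => exp (-c * ‖ξ‖ ^ 2) * ‖ξ‖ ^ (-2 : ℝ) := by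
  have : Nonempty (Fin n) := ⟨⟨0, by omega⟩⟩
  rw [integrable_fun_norm_addHaar volume
    (f := fun r : ℝ => exp (-c * r ^ 2) * r ^ (-2 : ℝ))]
  have hn' : (3 : ℝ) ≤ n := by exact_mod_cast hn
  refine (integrableOn_rpow_mul_exp_neg_mul_sq hc (s := (n : ℝ) - 3) (by linarith)).congr_fun
    (fun r hr => ?_) measurableSet_Ioi
  have hr : 0 < r := hr
  simp only [finrank_euclideanSpace, Fintype.card_fin, smul_eq_mul]
  rw [← rpow_natCast r (n - 1), Nat.cast_sub (by omega), mul_comm (exp _), ← mul_assoc,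
    ← rpow_add hr]
  congr 2
  push_cast
  ring

theorem exp_mul_rpow_comp_smul {n : ℕ} (c : ℝ) {t : ℝ} (ht : 0 < t)
    (ξ : EuclideanSpace ℝ (Fin n)) :
    exp (-c * (‖ξ‖ ^ 2 * t)) * ‖ξ‖ ^ (-2 : ℝ)
      = t * (exp (-c * ‖√t • ξ‖ ^ 2) * ‖√t • ξ‖ ^ (-2 : ℝ)) := by
  have hsq : ‖√t • ξ‖ ^ 2 = ‖ξ‖ ^ 2 * t := by
    rw [norm_smul, mul_pow, norm_of_nonneg (sqrt_nonneg t), sq_sqrt ht.le, mul_comm]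
  rw [rpow_neg (norm_nonneg _), rpow_neg (norm_nonneg _), rpow_two, rpow_two, hsq]
  field_simp

theorem integral_exp_mul_rpow_scaled {n : ℕ} (c : ℝ) {t : ℝ} (ht : 0 < t) :
    ∫ ξ : EuclideanSpace ℝ (Fin n), exp (-c * (‖ξ‖ ^ 2 * t)) * ‖ξ‖ ^ (-2 : ℝ)
      = t ^ (1 - (n : ℝ) / 2)
        * ∫ ξ : EuclideanSpace ℝ (Fin n), exp (-c * ‖ξ‖ ^ 2) * ‖ξ‖ ^ (-2 : ℝ) := by
  simp_rw [exp_mul_rpow_comp_smul c ht]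
  rw [integral_const_mul, Measure.integral_comp_smul volume
    (fun ξ : EuclideanSpace ℝ (Fin n) => exp (-c * ‖ξ‖ ^ 2) * ‖ξ‖ ^ (-2 : ℝ)), smul_eq_mul,
    ← mul_assoc, finrank_euclideanSpace, Fintype.card_fin, abs_of_nonneg (by positivity),
    sqrt_eq_rpow, ← rpow_natCast, ← rpow_mul ht.le, rpow_sub ht, rpow_one, div_eq_mul_inv t]
  congr 4
  ring

theorem sqrt_setIntegral_weightedKernel_le_linear (n : ℕ) {c1 c2 R : ℝ} (ν1 ν2 : ℝ)
    (hc1 : 0 ≤ c1) (hc2 : 0 ≤ c2) (hR : 0 ≤ R) :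
    ∃ A : ℝ, ∀ t : ℝ, 1 ≤ t →
      √(∫ ξ in {ξ : EuclideanSpace ℝ (Fin n) | ‖ξ‖ ≤ R}, weightedKernel ν1 ν2 c1 c2 t ‖ξ‖)
        ≤ A * (1 + t) := by
  set K := |ν1| + |ν2| + (c1 + c2) * R
  set S := {ξ : EuclideanSpace ℝ (Fin n) | ‖ξ‖ ≤ R}
  have hS : S = Metric.closedBall 0 R := by ext; simp [S]
  have hSm : MeasurableSet S := hS ▸ measurableSet_closedBall
  have hSv : volume S ≠ ⊤ := hS ▸ measure_closedBall_lt_top.ne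
  have hK : 0 ≤ K := by positivity
  refine ⟨√(volume.real S) * K, fun t ht => ?_⟩
  have ht0 : 0 ≤ t := by linarith
  have h : ∫ ξ in S, weightedKernel ν1 ν2 c1 c2 t ‖ξ‖ ≤ volume.real S * (K * t) ^ 2 := by
    rw [← smul_eq_mul, ← setIntegral_const]
    refine integral_mono_of_nonneg
      (Filter.Eventually.of_forall fun ξ => weightedKernel_nonneg _ _ _ _ _ (norm_nonneg _))
      (integrableOn_const hSv) ?_
    filter_upwards [ae_restrict_mem hSm] with ξ hξ
    exact weightedKernel_le_sq ν1 ν2 hc1 hc2 ht0 (norm_nonneg _) hξ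
  calc _ ≤ √(volume.real S * (K * t) ^ 2) := sqrt_le_sqrt h
    _ = √(volume.real S) * K * t := by
        rw [sqrt_mul measureReal_nonneg, sqrt_sq (by positivity), mul_assoc]
    _ ≤ _ := by gcongr; linarith

theorem sqrt_setIntegral_weightedKernel_le_rpow {n : ℕ} (hn : 3 ≤ n) {c1 c2 : ℝ} (ν1 ν2 R : ℝ)
    (hc1 : 0 < c1) (hc2 : 0 < c2) :
    ∃ A : ℝ, ∀ t : ℝ, 1 ≤ t →
      √(∫ ξ in {ξ : EuclideanSpace ℝ (Fin n) | ‖ξ‖ ≤ R}, weightedKernel ν1 ν2 c1 c2 t ‖ξ‖)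
        ≤ A * (1 + t) ^ ((1 : ℝ) / 2 - n / 4) := by
  set c := min c1 c2
  have hc : 0 < c := lt_min hc1 hc2
  set I := ∫ ξ : EuclideanSpace ℝ (Fin n), exp (-(2 * c) * ‖ξ‖ ^ 2) * ‖ξ‖ ^ (-2 : ℝ)
  have hn' : (3 : ℝ) ≤ n := by exact_mod_cast hn
  refine ⟨√(4 * I) * (2 : ℝ)⁻¹ ^ ((1 : ℝ) / 2 - n / 4), fun t ht => ?_⟩
  have ht0 : 0 < t := by linarith
  have hint : Integrable fun ξ : EuclideanSpace ℝ (Fin n) =>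
      4 * (exp (-(2 * c) * (‖ξ‖ ^ 2 * t)) * ‖ξ‖ ^ (-2 : ℝ)) := by
    simp_rw [exp_mul_rpow_comp_smul _ ht0]
    exact (((integrable_exp_neg_mul_sq_norm_mul_rpow hn (by positivity : 0 < 2 * c)).comp_smul
      (sqrt_pos.2 ht0).ne').const_mul t).const_mul 4
  have h : ∫ ξ in {ξ : EuclideanSpace ℝ (Fin n) | ‖ξ‖ ≤ R}, weightedKernel ν1 ν2 c1 c2 t ‖ξ‖
      ≤ 4 * I * t ^ (1 - (n : ℝ) / 2) := by
    calc _ ≤ ∫ ξ in {ξ : EuclideanSpace ℝ (Fin n) | ‖ξ‖ ≤ R},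
          4 * (exp (-(2 * c) * (‖ξ‖ ^ 2 * t)) * ‖ξ‖ ^ (-2 : ℝ)) :=
          integral_mono_of_nonneg
            (Filter.Eventually.of_forall fun ξ => weightedKernel_nonneg _ _ _ _ _ (norm_nonneg _))
            hint.integrableOn
            (Filter.Eventually.of_forall fun ξ => weightedKernel_le_gaussian ν1 ν2
              (min_le_left _ _) (min_le_right _ _) ht0.le (norm_nonneg _))
      _ ≤ ∫ ξ : EuclideanSpace ℝ (Fin n),
          4 * (exp (-(2 * c) * (‖ξ‖ ^ 2 * t)) * ‖ξ‖ ^ (-2 : ℝ)) :=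
          setIntegral_le_integral hint (Filter.Eventually.of_forall fun ξ =>
            mul_nonneg (by norm_num) (mul_nonneg (exp_pos _).le (rpow_nonneg (norm_nonneg _) _)))
      _ = _ := by
          rw [integral_const_mul, integral_exp_mul_rpow_scaled _ ht0]
          ring
  have hI : 0 ≤ 4 * I := mul_nonneg (by norm_num) (integral_nonneg fun ξ =>
    mul_nonneg (exp_pos _).le (rpow_nonneg (norm_nonneg _) _))
  calc _ ≤ √(4 * I * t ^ (1 - (n : ℝ) / 2)) := sqrt_le_sqrt h
    _ = √(4 * I) * t ^ ((1 : ℝ) / 2 - n / 4) := by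
        rw [sqrt_mul hI, sqrt_eq_rpow (t ^ _), ← rpow_mul ht0.le]
        congr 2
        ring
    _ ≤ √(4 * I) * (2⁻¹ * (1 + t)) ^ ((1 : ℝ) / 2 - n / 4) := by
        refine mul_le_mul_of_nonneg_left ?_ (sqrt_nonneg _)
        exact rpow_le_rpow_of_nonpos (by positivity) (by linarith) (by linarith)
    _ = _ := by rw [mul_rpow (by norm_num) (by linarith), mul_assoc]

theorem one_le_sqrt_log_exp_add {t : ℝ} (ht : 0 ≤ t) : 1 ≤ √(log (exp 1 + t)) := by
  rw [one_le_sqrt, le_log_iff_exp_le (by positivity)]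
  linarith

theorem Drate_pos (n : ℕ) {t : ℝ} (ht : 0 ≤ t) : 0 < Drate n t := by
  have := one_le_sqrt_log_exp_add ht
  unfold Drate
  split_ifs <;> positivity

theorem rpow_le_Drate {n : ℕ} (hn : 3 ≤ n) {t : ℝ} (ht : 0 ≤ t) :
    (1 + t) ^ ((1 : ℝ) - n / 4) ≤ Drate n t := by
  have hlog := one_le_sqrt_log_exp_add ht
  unfold Drate
  split_ifs with h1 h2
  · obtain rfl : n = 3 := by omega
    exact rpow_le_rpow_of_exponent_le (by linarith) (by norm_num)
  · obtain rfl : n = 4 := by omega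
    norm_num
    exact one_le_sqrt.1 hlog
  · exact le_rfl

theorem tendsto_one_add_div_Drate {n : ℕ} (hn : n = 1 ∨ n = 2) :
    Filter.Tendsto (fun t : ℝ => (1 + t) / Drate n t) Filter.atTop (nhds 0) := by
  rcases hn with rfl | rfl
  · have h := (tendsto_rpow_neg_atTop (show (0 : ℝ) < 1 / 2 by norm_num)).comp
      (Filter.tendsto_atTop_add_const_left _ (1 : ℝ) Filter.tendsto_id)
    refine h.congr' ?_
    filter_upwards [Filter.eventually_ge_atTop 0] with t ht
    have ht1 : 0 < 1 + t := by linarith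
    simp only [Drate, Function.comp, id]
    norm_num
    rw [eq_div_iff (by positivity), ← rpow_add ht1]
    norm_num
  · have h := (tendsto_sqrt_atTop.comp (tendsto_log_atTop.comp
      (Filter.tendsto_atTop_add_const_left _ (exp 1) Filter.tendsto_id))).inv_tendsto_atTop
    refine h.congr' ?_
    filter_upwards [Filter.eventually_ge_atTop 0] with t ht
    have ht1 : 0 < 1 + t := by linarith
    have hlog := one_le_sqrt_log_exp_add ht
    simp only [Drate, Function.comp, id, Pi.inv_apply]
    norm_num
    field_simp

theorem tendsto_rpow_div_Drate {n : ℕ} (hn : 3 ≤ n) :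
    Filter.Tendsto (fun t : ℝ => (1 + t) ^ ((1 : ℝ) / 2 - n / 4) / Drate n t)
      Filter.atTop (nhds 0) := by
  have h := (tendsto_rpow_neg_atTop (show (0 : ℝ) < 1 / 2 by norm_num)).comp
    (Filter.tendsto_atTop_add_const_left _ (1 : ℝ) Filter.tendsto_id)
  refine squeeze_zero' ?_ ?_ h
  · filter_upwards [Filter.eventually_ge_atTop 0] with t ht
    have := Drate_pos n ht
    positivity
  · filter_upwards [Filter.eventually_ge_atTop 0] with t ht
    have ht1 : 0 < 1 + t := by linarith
    simp only [Function.comp, id]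
    rw [div_le_iff₀ (Drate_pos n ht)]
    calc (1 + t) ^ ((1 : ℝ) / 2 - n / 4)
        = (1 + t) ^ (-(1 / 2) : ℝ) * (1 + t) ^ ((1 : ℝ) - n / 4) := by
          rw [← rpow_add ht1]
          congr 1
          ring
      _ ≤ _ := by gcongr; exact rpow_le_Drate hn ht

theorem tendsto_div_Drate_of_le {n : ℕ} {N g : ℝ → ℝ} {A : ℝ} (hN : ∀ t, 0 ≤ N t)
    (hle : ∀ t, 1 ≤ t → N t ≤ A * g t)
    (hg : Filter.Tendsto (fun t => g t / Drate n t) Filter.atTop (nhds 0)) :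
    Filter.Tendsto (fun t => N t / Drate n t) Filter.atTop (nhds 0) := by
  have h := hg.const_mul A
  rw [mul_zero] at h
  refine squeeze_zero' ?_ ?_ h
  · filter_upwards [Filter.eventually_ge_atTop 0] with t ht
    exact div_nonneg (hN t) (Drate_pos n ht).le
  · filter_upwards [Filter.eventually_ge_atTop 1] with t ht
    rw [← mul_div_assoc]
    exact div_le_div_of_nonneg_right (hle t ht) (Drate_pos n (by linarith)).le

theorem typeIII_cosine_kernel_small_o (n : ℕ) (hn : 1 ≤ n) (ε0 : ℝ) (hε0 : 0 < ε0)
    (b κ γ δ : ℝ) (hb : 0 < b) (hκ : 0 < κ) (hγ : γ ≠ 0) (hδ : 0 < δ)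
    (α0 α1 α2 ν1 ν2 c1 c2 : ℝ)
    (hα0 : α0 = b ^ 2 - κ - γ ^ 2) (hα1 : α1 = b ^ 2 + κ + γ ^ 2)
    (hα2 : α2 = Real.sqrt (α1 ^ 2 - 4 * b ^ 2 * κ))
    (hν1 : ν1 = Real.sqrt ((α1 + α2) / 2)) (hν2 : ν2 = Real.sqrt ((α1 - α2) / 2))
    (hc1 : c1 = δ / 4 * (1 - α0 / α2)) (hc2 : c2 = δ / 4 * (1 + α0 / α2)) :
    Filter.Tendsto
      (fun t : ℝ =>
        Real.sqrt (∫ ξ in {ξ : EuclideanSpace ℝ (Fin n) | ‖ξ‖ ≤ ε0},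
          |Real.cos (ν1 * ‖ξ‖ * t) * Real.exp (-(c1 * ‖ξ‖ ^ 2 * t))
            - Real.cos (ν2 * ‖ξ‖ * t) * Real.exp (-(c2 * ‖ξ‖ ^ 2 * t))| ^ 2
            * ‖ξ‖ ^ (-2 : ℝ)) / Drate n t)
      Filter.atTop (nhds 0) := by
  have hlt : |α0| < α2 := by
    rw [hα2, hα0, hα1]
    exact lt_sqrt_of_sq_lt (by rw [sq_abs]; exact sq_sub_sub_lt_discrim hb hγ)
  have hα2pos : 0 < α2 := (abs_nonneg _).trans_lt hlt
  obtain ⟨hlow, hupp⟩ := abs_lt.1 hlt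
  have h1 : α0 / α2 < 1 := (div_lt_one hα2pos).2 hupp
  have h2 : -1 < α0 / α2 := by
    rw [lt_div_iff₀ hα2pos]
    linarith
  have hc1pos : 0 < c1 := hc1 ▸ mul_pos (by positivity) (by linarith)
  have hc2pos : 0 < c2 := hc2 ▸ mul_pos (by positivity) (by linarith)
  rcases lt_or_ge n 3 with hn3 | hn3
  · obtain ⟨A, hle⟩ := sqrt_setIntegral_weightedKernel_le_linear n ν1 ν2 hc1pos.le hc2pos.le
      hε0.le
    exact tendsto_div_Drate_of_le (fun t => sqrt_nonneg _) hle
      (tendsto_one_add_div_Drate (by omega))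
  · obtain ⟨A, hle⟩ := sqrt_setIntegral_weightedKernel_le_rpow hn3 ν1 ν2 ε0 hc1pos hc2pos
    exact tendsto_div_Drate_of_le (fun t => sqrt_nonneg _) hle (tendsto_rpow_div_Drate hn3)
end

section
/- Let n ≥ 1 be an integer, ε0 > 0, and let b, κ, γ, δ and the derived constants α0, α1, α2, ν1, ν2, c1, c2 be as in the thermoelastic type III parameter setting. Define P(t) := ( ∫_{ξ ∈ ℝⁿ, |ξ| ≤ ε0} (1/(4α2²))·|(α0−α2)·sin(ν1|ξ|t)/(ν1|ξ|)·exp(−c1|ξ|²t) − (α0+α2)·sin(ν2|ξ|t)/(ν2|ξ|)·exp(−c2|ξ|²t)|² dξ )^{1/2} for t > 0. Then: (i) there exists C > 0 such that P(t) ≤ C·ℰ_n(1+t) for all t > 0; and (ii) assuming additionally (α0−α2)²(α1−α2) > 2(α0+α2)²(α1+α2) or (α0+α2)²(α1+α2) > 2(α0−α2)²(α1−α2) in case n = 2 (no extra assumption in other dimensions), there exist c > 0 and T > 0 such that P(t) ≥ c·ℰ_n(1+t) for all t ≥ T. -/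
open MeasureTheory Real

/-- A damped sine mode `sin (ν r t) / (ν r) * exp (-c r² t)` at radial frequency `r`. -/
noncomputable def dampedMode (ν c t r : ℝ) : ℝ :=
  Real.sin (ν * r * t) / (ν * r) * Real.exp (-(c * r ^ 2 * t))

lemma measurable_dampedMode (ν c t : ℝ) : Measurable (dampedMode ν c t) := by
  unfold dampedMode
  fun_prop

lemma dampedMode_sq (ν c t r : ℝ) :
    dampedMode ν c t r ^ 2
      = Real.sin (ν * r * t) ^ 2 / (ν * r) ^ 2 * Real.exp (-(2 * c * r ^ 2 * t)) := by
  rw [dampedMode, mul_pow, div_pow, ← Real.exp_nat_mul]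
  congr 2
  push_cast
  ring

lemma exp_neg_damping_le_one {c t : ℝ} (hc : 0 ≤ c) (ht : 0 ≤ t) (r : ℝ) :
    Real.exp (-(c * r ^ 2 * t)) ≤ 1 :=
  Real.exp_le_one_iff.2 (neg_nonpos.2 (by positivity))

lemma abs_dampedMode_le {ν c t : ℝ} (hν : 0 < ν) (hc : 0 ≤ c) (ht : 0 ≤ t) {r : ℝ}
    (hr : 0 ≤ r) : |dampedMode ν c t r| ≤ t := by
  rcases hr.eq_or_lt with rfl | hr
  · simpa [dampedMode] using ht
  have hνr : 0 < ν * r := by positivity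
  rw [dampedMode, abs_mul, abs_div, Real.abs_exp, abs_of_pos hνr]
  have hsin : |Real.sin (ν * r * t)| / (ν * r) ≤ t := by
    rw [div_le_iff₀ hνr]
    calc |Real.sin (ν * r * t)| ≤ |ν * r * t| := Real.abs_sin_le_abs
      _ = t * (ν * r) := by rw [abs_of_nonneg (by positivity)]; ring
  calc _ ≤ t * 1 := mul_le_mul hsin (exp_neg_damping_le_one hc ht r) (Real.exp_nonneg _) ht
    _ = t := mul_one t

lemma sin_sq_le_two_mul_sq_div (x : ℝ) : Real.sin x ^ 2 ≤ 2 * x ^ 2 / (1 + x ^ 2) := by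
  rw [le_div_iff₀ (by positivity)]
  have h₁ : Real.sin x ^ 2 ≤ x ^ 2 := sq_le_sq.2 Real.abs_sin_le_abs
  nlinarith [Real.sin_sq_le_one x, sq_nonneg x]

lemma dampedMode_sq_le {ν c t : ℝ} (hν : 0 < ν) (hc : 0 ≤ c) (ht : 0 ≤ t) {r : ℝ}
    (hr : 0 < r) : dampedMode ν c t r ^ 2 ≤ 2 * t ^ 2 / (1 + (ν * r * t) ^ 2) := by
  rw [dampedMode_sq]
  calc _ ≤ Real.sin (ν * r * t) ^ 2 / (ν * r) ^ 2 * 1 := by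
        gcongr
        exact exp_neg_damping_le_one (by positivity) ht r
    _ ≤ 2 * (ν * r * t) ^ 2 / (1 + (ν * r * t) ^ 2) / (ν * r) ^ 2 := by
        rw [mul_one]
        gcongr
        exact sin_sq_le_two_mul_sq_div _
    _ = _ := by field_simp

lemma integrableOn_dampedMode_comb (n : ℕ) {ν₁ ν₂ c₁ c₂ : ℝ} (A B R : ℝ) {t : ℝ}
    (hν₁ : 0 < ν₁) (hν₂ : 0 < ν₂) (hc₁ : 0 ≤ c₁) (hc₂ : 0 ≤ c₂) (ht : 0 ≤ t) :
    IntegrableOn (fun r => r ^ n * (A * dampedMode ν₁ c₁ t r - B * dampedMode ν₂ c₂ t r) ^ 2)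
      (Set.Icc 0 R) := by
  refine Measure.integrableOn_of_bounded (M := R ^ n * (|A| * t + |B| * t) ^ 2) (by simp) ?_ ?_
  · have h₁ := measurable_dampedMode ν₁ c₁ t
    have h₂ := measurable_dampedMode ν₂ c₂ t
    exact Measurable.aestronglyMeasurable (by fun_prop)
  · refine (ae_restrict_iff' measurableSet_Icc).2 (.of_forall fun r hr => ?_)
    have h : |A * dampedMode ν₁ c₁ t r - B * dampedMode ν₂ c₂ t r| ≤ |A| * t + |B| * t := by
      refine (abs_sub _ _).trans ?_
      rw [abs_mul, abs_mul]
      gcongr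
      · exact abs_dampedMode_le hν₁ hc₁ ht hr.1
      · exact abs_dampedMode_le hν₂ hc₂ ht hr.1
    rw [Real.norm_eq_abs, abs_mul, abs_pow, abs_pow, abs_of_nonneg hr.1]
    obtain ⟨hr₀, hrR⟩ := hr
    have hR : 0 ≤ R := hr₀.trans hrR
    gcongr

lemma integrableOn_dampedMode_sq (n : ℕ) {ν c : ℝ} (R : ℝ) {t : ℝ}
    (hν : 0 < ν) (hc : 0 ≤ c) (ht : 0 ≤ t) :
    IntegrableOn (fun r => r ^ n * dampedMode ν c t r ^ 2) (Set.Icc 0 R) := by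
  simpa using integrableOn_dampedMode_comb n 1 0 R hν hν hc hc ht

lemma setIntegral_norm_le_eq_radial {n : ℕ} (hn : 1 ≤ n) (R : ℝ) (f : ℝ → ℝ) :
    ∫ ξ in {ξ : EuclideanSpace ℝ (Fin n) | ‖ξ‖ ≤ R}, f ‖ξ‖
      = n * volume.real (Metric.ball (0 : EuclideanSpace ℝ (Fin n)) 1)
        * ∫ r in Set.Ioc 0 R, r ^ (n - 1) * f r := by
  have : Nonempty (Fin n) := ⟨⟨0, hn⟩⟩
  have hmeas : MeasurableSet {ξ : EuclideanSpace ℝ (Fin n) | ‖ξ‖ ≤ R} :=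
    measurableSet_le measurable_norm measurable_const
  rw [← integral_indicator hmeas]
  have hind : Set.indicator {ξ : EuclideanSpace ℝ (Fin n) | ‖ξ‖ ≤ R} (fun ξ => f ‖ξ‖)
      = fun ξ => (Set.Iic R).indicator f ‖ξ‖ := by
    ext ξ
    simp [Set.indicator]
  rw [hind, integral_fun_norm_addHaar volume ((Set.Iic R).indicator f), finrank_euclideanSpace,
    Fintype.card_fin, nsmul_eq_mul, smul_eq_mul, ← mul_assoc]
  congr 1
  rw [← Set.Ioi_inter_Iic, ← setIntegral_indicator measurableSet_Iic]
  congr 1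
  ext r
  by_cases hr : r ≤ R <;> simp [Set.indicator, hr]

lemma Erate_nonneg (n : ℕ) {t : ℝ} (ht : 0 ≤ t) : 0 ≤ Erate n t := by
  unfold Erate
  split_ifs <;> positivity

lemma Erate_one_sq {t : ℝ} (ht : 0 ≤ t) : Erate 1 t ^ 2 = 1 + t := by
  rw [Erate, if_pos rfl, Real.sq_sqrt (by positivity)]

lemma one_le_log_exp_one_add {t : ℝ} (ht : 0 ≤ t) : 1 ≤ Real.log (Real.exp 1 + t) := by
  rw [Real.le_log_iff_exp_le (by positivity)]
  linarith

lemma Erate_two_sq {t : ℝ} (ht : 0 ≤ t) : Erate 2 t ^ 2 = Real.log (Real.exp 1 + t) := by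
  rw [Erate, if_neg (by norm_num), if_pos rfl,
    Real.sq_sqrt (by linarith [one_le_log_exp_one_add ht])]

lemma Erate_add_three_sq (p : ℕ) {t : ℝ} (ht : 0 ≤ t) :
    Erate (p + 3) t ^ 2 = (1 + t) ^ (-((p : ℝ) + 1) / 2) := by
  rw [Erate, if_neg (by omega), if_neg (by omega), ← Real.rpow_natCast,
    ← Real.rpow_mul (by positivity)]
  congr 1
  push_cast
  ring

lemma radial_dampedMode_sq_le_one {ν c R t : ℝ} (hν : 0 < ν) (hc : 0 ≤ c) (hR : 0 ≤ R)
    (ht : 0 ≤ t) :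
    ∫ r in Set.Ioc 0 R, r ^ 0 * dampedMode ν c t r ^ 2 ≤ π / ν * t := by
  rw [← intervalIntegral.integral_of_le hR]
  have h := intervalIntegral.integral_le_sub_of_hasDeriv_right_of_le
    (g := fun r => 2 * t / ν * Real.arctan (ν * r * t))
    (g' := fun r => 2 * t ^ 2 / (1 + (ν * r * t) ^ 2)) hR (by fun_prop) ?_
    (integrableOn_dampedMode_sq 0 R hν hc ht) ?_
  · refine h.trans ?_
    have := (Real.arctan_lt_pi_div_two (ν * R * t)).le
    calc _ ≤ 2 * t / ν * (π / 2) - 2 * t / ν * Real.arctan (ν * 0 * t) := by gcongr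
      _ = _ := by simp; ring
  · intro r _
    have h := (((hasDerivAt_id r).const_mul ν).mul_const t).arctan.const_mul (2 * t / ν)
    refine HasDerivAt.hasDerivWithinAt ?_
    convert! h using 1
    simp only [id_eq]
    field_simp
  · intro r hr
    simpa using dampedMode_sq_le hν hc ht hr.1

lemma radial_dampedMode_sq_le_two {ν c R t : ℝ} (hν : 0 < ν) (hc : 0 ≤ c) (hR : 0 ≤ R)
    (ht : 0 ≤ t) :
    ∫ r in Set.Ioc 0 R, r ^ 1 * dampedMode ν c t r ^ 2
      ≤ 2 / ν ^ 2 * (Real.log (1 + ν * R) + 1) * Real.log (Real.exp 1 + t) := by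
  rw [← intervalIntegral.integral_of_le hR]
  have hpos : ∀ r : ℝ, 1 + (ν * r * t) ^ 2 ≠ 0 := fun r => by positivity
  have h := intervalIntegral.integral_le_sub_of_hasDeriv_right_of_le
    (g := fun r => 1 / ν ^ 2 * Real.log (1 + (ν * r * t) ^ 2))
    (g' := fun r => r * (2 * t ^ 2 / (1 + (ν * r * t) ^ 2))) hR ?_ ?_
    (integrableOn_dampedMode_sq 1 R hν hc ht) ?_
  · refine h.trans ?_
    have hlog := one_le_log_exp_one_add ht
    have hlog₀ : 0 ≤ Real.log (1 + ν * R) := Real.log_nonneg (by nlinarith [mul_nonneg hν.le hR])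
    have hle : Real.log (1 + (ν * R * t) ^ 2)
        ≤ 2 * (Real.log (1 + ν * R) + Real.log (Real.exp 1 + t)) := by
      rw [← Real.log_mul (by positivity) (by positivity)]
      calc _ ≤ Real.log (((1 + ν * R) * (Real.exp 1 + t)) ^ 2) := by
            apply Real.log_le_log (by positivity)
            have h₁ : 1 + ν * R * t ≤ (1 + ν * R) * (Real.exp 1 + t) := by
              have := Real.add_one_le_exp 1
              nlinarith [mul_nonneg hν.le hR, mul_nonneg (mul_nonneg hν.le hR) (Real.exp_nonneg 1)]
            have h₂ : 0 ≤ ν * R * t := by positivity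
            nlinarith
        _ = _ := by rw [Real.log_pow]; norm_num
    simp only [mul_zero, zero_mul]
    calc _ ≤ 1 / ν ^ 2 * (2 * (Real.log (1 + ν * R) + Real.log (Real.exp 1 + t)))
          - 1 / ν ^ 2 * Real.log (1 + 0 ^ 2) := by gcongr
      _ = 2 / ν ^ 2 * (Real.log (1 + ν * R) + Real.log (Real.exp 1 + t)) := by simp; ring
      _ ≤ _ := by
          rw [mul_assoc]
          gcongr
          nlinarith
  · exact Continuous.continuousOn (by fun_prop (disch := exact hpos _))
  · intro r _
    have h := (((((hasDerivAt_id r).const_mul ν).mul_const t).pow 2).const_add 1).log (hpos r)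
    have h := h.const_mul (1 / ν ^ 2)
    refine HasDerivAt.hasDerivWithinAt ?_
    convert! h using 1
    have := hpos r
    simp only [id_eq, Pi.pow_apply]
    field_simp
    norm_num
    ring
  · intro r hr
    have := dampedMode_sq_le hν hc ht hr.1
    rw [pow_one]
    gcongr
    exact hr.1.le

lemma radial_dampedMode_sq_le_add_three (p : ℕ) {ν c R : ℝ} (hν : 0 < ν) (hc : 0 < c) :
    ∃ C > 0, ∀ t ≥ 0, ∫ r in Set.Ioc 0 R, r ^ (p + 2) * dampedMode ν c t r ^ 2
      ≤ C * (1 + t) ^ (-((p : ℝ) + 1) / 2) := by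
  have hp : (0 : ℝ) < p + 1 := by positivity
  refine ⟨Real.exp (2 * c * R ^ 2) / ν ^ 2 * ((2 * c) ^ (-((p : ℝ) + 1) / 2) * (1 / 2)
    * Real.Gamma ((p + 1) / 2)), ?_, ?_⟩
  · have := Real.Gamma_pos_of_pos (show (0 : ℝ) < (p + 1) / 2 by positivity)
    positivity
  · intro t ht
    have hb : 0 < 2 * c * (1 + t) := by positivity
    have hint := integrableOn_rpow_mul_exp_neg_mul_rpow (p := 2) (s := p) (by linarith) two_pos hb
    have hval := integral_rpow_mul_exp_neg_mul_rpow (p := 2) (q := p) two_pos (by linarith) hb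
    calc ∫ r in Set.Ioc 0 R, r ^ (p + 2) * dampedMode ν c t r ^ 2
        ≤ ∫ r in Set.Ioc 0 R, Real.exp (2 * c * R ^ 2) / ν ^ 2
            * (r ^ (p : ℝ) * Real.exp (-(2 * c * (1 + t)) * r ^ (2 : ℝ))) := by
          refine setIntegral_mono_on ?_ ?_ measurableSet_Ioc fun r hr => ?_
          · exact (integrableOn_dampedMode_sq (p + 2) R hν hc.le ht).mono_set Set.Ioc_subset_Icc_self
          · exact (hint.mono_set Set.Ioc_subset_Ioi_self).const_mul _
          · have hr₀ := hr.1
            have hrR := hr.2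
            rw [dampedMode_sq, Real.rpow_natCast, Real.rpow_two]
            have hsin := Real.sin_sq_le_one (ν * r * t)
            have hexp : Real.exp (-(2 * c * r ^ 2 * t))
                ≤ Real.exp (2 * c * R ^ 2) * Real.exp (-(2 * c * (1 + t)) * r ^ 2) := by
              rw [← Real.exp_add]
              apply Real.exp_le_exp.2
              have : c * r ^ 2 ≤ c * R ^ 2 := by gcongr
              linarith
            calc _ ≤ r ^ (p + 2) * (1 / (ν * r) ^ 2
                  * (Real.exp (2 * c * R ^ 2) * Real.exp (-(2 * c * (1 + t)) * r ^ 2))) := by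
                  gcongr
              _ = _ := by field_simp; ring
      _ = Real.exp (2 * c * R ^ 2) / ν ^ 2 * ∫ r in Set.Ioc 0 R,
            r ^ (p : ℝ) * Real.exp (-(2 * c * (1 + t)) * r ^ (2 : ℝ)) := integral_const_mul _ _
      _ ≤ Real.exp (2 * c * R ^ 2) / ν ^ 2 * ∫ r in Set.Ioi 0,
            r ^ (p : ℝ) * Real.exp (-(2 * c * (1 + t)) * r ^ (2 : ℝ)) := by
          refine mul_le_mul_of_nonneg_left ?_ (by positivity)
          refine setIntegral_mono_set hint ?_ Set.Ioc_subset_Ioi_self.eventuallyLE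
          refine (ae_restrict_iff' measurableSet_Ioi).2 (.of_forall fun r hr => ?_)
          have : (0 : ℝ) < r := hr
          positivity
      _ = _ := by
          rw [hval, Real.mul_rpow (by positivity) (by positivity)]
          ring

lemma radial_dampedMode_sq_le {n : ℕ} (hn : 1 ≤ n) {ν c R : ℝ} (hν : 0 < ν) (hc : 0 < c)
    (hR : 0 ≤ R) :
    ∃ C > 0, ∀ t ≥ 0, ∫ r in Set.Ioc 0 R, r ^ (n - 1) * dampedMode ν c t r ^ 2
      ≤ C * Erate n t ^ 2 := by
  match n, hn with
  | 1, _ =>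
    refine ⟨π / ν, by positivity, fun t ht => (radial_dampedMode_sq_le_one hν hc.le hR ht).trans ?_⟩
    rw [Erate_one_sq ht]
    gcongr
    linarith
  | 2, _ =>
    have : 0 ≤ Real.log (1 + ν * R) := Real.log_nonneg (by nlinarith [mul_nonneg hν.le hR])
    refine ⟨2 / ν ^ 2 * (Real.log (1 + ν * R) + 1), by positivity, fun t ht => ?_⟩
    rw [Erate_two_sq ht]
    exact radial_dampedMode_sq_le_two hν hc.le hR ht
  | p + 3, _ =>
    obtain ⟨C, hC, h⟩ := radial_dampedMode_sq_le_add_three p (R := R) hν hc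
    refine ⟨C, hC, fun t ht => ?_⟩
    rw [Erate_add_three_sq p ht]
    exact h t ht

lemma radial_dampedMode_comb_le {n : ℕ} (hn : 1 ≤ n) {ν₁ ν₂ c₁ c₂ : ℝ} (A B : ℝ) {R : ℝ}
    (hν₁ : 0 < ν₁) (hν₂ : 0 < ν₂) (hc₁ : 0 < c₁) (hc₂ : 0 < c₂) (hR : 0 ≤ R) :
    ∃ C > 0, ∀ t ≥ 0, ∫ r in Set.Ioc 0 R,
        r ^ (n - 1) * (A * dampedMode ν₁ c₁ t r - B * dampedMode ν₂ c₂ t r) ^ 2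
      ≤ C * Erate n t ^ 2 := by
  obtain ⟨C₁, hC₁, h₁⟩ := radial_dampedMode_sq_le hn hν₁ hc₁ hR
  obtain ⟨C₂, hC₂, h₂⟩ := radial_dampedMode_sq_le hn hν₂ hc₂ hR
  refine ⟨2 * A ^ 2 * C₁ + 2 * B ^ 2 * C₂ + 1, by positivity, fun t ht => ?_⟩
  have hi₁ := (integrableOn_dampedMode_sq (n - 1) R hν₁ hc₁.le ht).mono_set
    (Set.Ioc_subset_Icc_self)
  have hi₂ := (integrableOn_dampedMode_sq (n - 1) R hν₂ hc₂.le ht).mono_set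
    (Set.Ioc_subset_Icc_self)
  calc _ ≤ ∫ r in Set.Ioc 0 R, (2 * A ^ 2 * (r ^ (n - 1) * dampedMode ν₁ c₁ t r ^ 2)
        + 2 * B ^ 2 * (r ^ (n - 1) * dampedMode ν₂ c₂ t r ^ 2)) := by
        refine setIntegral_mono_on ?_ ((hi₁.const_mul _).add (hi₂.const_mul _)) measurableSet_Ioc
          fun r hr => ?_
        · exact (integrableOn_dampedMode_comb (n - 1) A B R hν₁ hν₂ hc₁.le hc₂.le ht).mono_set
            Set.Ioc_subset_Icc_self
        · have hr₀ := hr.1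
          calc _ ≤ r ^ (n - 1) * (2 * (A * dampedMode ν₁ c₁ t r) ^ 2
                + 2 * (B * dampedMode ν₂ c₂ t r) ^ 2) := by
                gcongr
                nlinarith [sq_nonneg (A * dampedMode ν₁ c₁ t r + B * dampedMode ν₂ c₂ t r)]
            _ = _ := by ring
    _ = 2 * A ^ 2 * (∫ r in Set.Ioc 0 R, r ^ (n - 1) * dampedMode ν₁ c₁ t r ^ 2)
        + 2 * B ^ 2 * ∫ r in Set.Ioc 0 R, r ^ (n - 1) * dampedMode ν₂ c₂ t r ^ 2 := by
        rw [integral_add (hi₁.const_mul _) (hi₂.const_mul _), integral_const_mul,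
          integral_const_mul]
    _ ≤ 2 * A ^ 2 * (C₁ * Erate n t ^ 2) + 2 * B ^ 2 * (C₂ * Erate n t ^ 2) := by
        gcongr
        · exact h₁ t ht
        · exact h₂ t ht
    _ ≤ _ := by nlinarith [sq_nonneg (Erate n t)]

/-- The square of a sum of two sines of different frequencies has mean `(a² + b²) / 2`, up to the
derivative of a bounded function. -/
lemma exists_bounded_primitive_sq_sin_add_sin {ν₁ ν₂ : ℝ} (hν₁ : 0 < ν₁) (hν₂ : 0 < ν₂)
    (hν : ν₁ ≠ ν₂) (a₁ a₂ : ℝ) :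
    ∃ Q : ℝ → ℝ, ∃ K, (∀ x, |Q x| ≤ K) ∧ ∀ x, HasDerivAt Q
      ((a₁ * Real.sin (ν₁ * x) + a₂ * Real.sin (ν₂ * x)) ^ 2 - (a₁ ^ 2 + a₂ ^ 2) / 2) x := by
  have hsub : ν₁ - ν₂ ≠ 0 := sub_ne_zero.2 hν
  have hadd : ν₁ + ν₂ ≠ 0 := by positivity
  have hbound : ∀ k y : ℝ, |k * Real.sin y| ≤ |k| := fun k y => by
    rw [abs_mul]
    exact mul_le_of_le_one_right (abs_nonneg k) (Real.abs_sin_le_one y)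
  have hderiv : ∀ k μ x : ℝ,
      HasDerivAt (fun x => k * Real.sin (μ * x)) (k * (Real.cos (μ * x) * μ)) x := fun k μ x => by
    simpa using (((hasDerivAt_id x).const_mul μ).sin).const_mul k
  refine ⟨fun x => -a₁ ^ 2 / (4 * ν₁) * Real.sin (2 * ν₁ * x)
      + -a₂ ^ 2 / (4 * ν₂) * Real.sin (2 * ν₂ * x)
      + a₁ * a₂ / (ν₁ - ν₂) * Real.sin ((ν₁ - ν₂) * x)
      + -(a₁ * a₂) / (ν₁ + ν₂) * Real.sin ((ν₁ + ν₂) * x),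
    |-a₁ ^ 2 / (4 * ν₁)| + |-a₂ ^ 2 / (4 * ν₂)| + |a₁ * a₂ / (ν₁ - ν₂)|
      + |-(a₁ * a₂) / (ν₁ + ν₂)|, fun x => ?_, fun x => ?_⟩
  · refine (abs_add_le _ _).trans (add_le_add ((abs_add_le _ _).trans (add_le_add
      ((abs_add_le _ _).trans (add_le_add (hbound _ _) (hbound _ _))) (hbound _ _))) (hbound _ _))
  · convert! (((hderiv (-a₁ ^ 2 / (4 * ν₁)) (2 * ν₁) x).add
      (hderiv (-a₂ ^ 2 / (4 * ν₂)) (2 * ν₂) x)).add (hderiv (a₁ * a₂ / (ν₁ - ν₂)) (ν₁ - ν₂) x)).add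
      (hderiv (-(a₁ * a₂) / (ν₁ + ν₂)) (ν₁ + ν₂) x) using 1
    have h₁ : Real.cos (2 * ν₁ * x) = 1 - 2 * Real.sin (ν₁ * x) ^ 2 := by
      rw [mul_assoc, Real.cos_two_mul, Real.cos_sq']; ring
    have h₂ : Real.cos (2 * ν₂ * x) = 1 - 2 * Real.sin (ν₂ * x) ^ 2 := by
      rw [mul_assoc, Real.cos_two_mul, Real.cos_sq']; ring
    rw [h₁, h₂, sub_mul ν₁, add_mul ν₁, Real.cos_sub, Real.cos_add]
    field_simp
    ring

/-- In the zone `r² t ≤ σ` the damping factors are close to `1`, so that the squared combination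
of modes is bounded below by a positive mean plus a bounded oscillation. -/
lemma exists_lower_bound_dampedMode_comb {ν₁ ν₂ c₁ c₂ A B : ℝ} (hν₁ : 0 < ν₁) (hν₂ : 0 < ν₂)
    (hν : ν₁ ≠ ν₂) (hc₁ : 0 < c₁) (hc₂ : 0 < c₂) (hA : A ≠ 0) :
    ∃ m > 0, ∃ σ > 0, ∃ K : ℝ, ∃ Q q : ℝ → ℝ, (∀ x, |Q x| ≤ K) ∧ (∀ x, HasDerivAt Q (q x) x) ∧
      ∀ t ≥ 0, ∀ r > 0, r ^ 2 * t ≤ σ →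
        m + q (r * t) ≤ (r * (A * dampedMode ν₁ c₁ t r - B * dampedMode ν₂ c₂ t r)) ^ 2 := by
  set a₁ := A / ν₁ with ha₁
  set a₂ := -B / ν₂ with ha₂
  obtain ⟨Q, K, hQ, hQ'⟩ := exists_bounded_primitive_sq_sin_add_sin hν₁ hν₂ hν a₁ a₂
  set M := (a₁ ^ 2 + a₂ ^ 2) / 2 with hM
  have hMpos : 0 < M := by positivity
  set D := |a₁| * c₁ + |a₂| * c₂ with hD
  have hDpos : 0 < D := by positivity
  refine ⟨M / 4, by positivity, Real.sqrt M / (2 * D), by positivity, K / 2, fun x => Q x / 2, _,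
    fun x => ?_, fun x => (hQ' x).div_const 2, fun t ht r hr hrt => ?_⟩
  · rw [abs_div, abs_two]
    exact div_le_div_of_nonneg_right (hQ x) two_pos.le
  · set S := a₁ * Real.sin (ν₁ * (r * t)) + a₂ * Real.sin (ν₂ * (r * t)) with hS
    set E := r * (A * dampedMode ν₁ c₁ t r - B * dampedMode ν₂ c₂ t r) with hE
    have hfac : ∀ {a c s : ℝ}, 0 < c → |s| ≤ 1 →
        |a * s * (1 - Real.exp (-(c * r ^ 2 * t)))| ≤ |a| * c * (r ^ 2 * t) := by
      intro a c s hc hs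
      have h₀ := exp_neg_damping_le_one hc.le ht r
      have h₁ := Real.add_one_le_exp (-(c * r ^ 2 * t))
      rw [abs_mul, abs_mul, abs_of_nonneg (sub_nonneg.2 h₀)]
      calc _ ≤ |a| * 1 * (c * r ^ 2 * t) := by
            gcongr
            linarith
        _ = _ := by ring
    have hdiff : S - E = a₁ * Real.sin (ν₁ * r * t) * (1 - Real.exp (-(c₁ * r ^ 2 * t)))
        + a₂ * Real.sin (ν₂ * r * t) * (1 - Real.exp (-(c₂ * r ^ 2 * t))) := by
      rw [hS, hE, ha₁, ha₂, dampedMode, dampedMode, mul_assoc ν₁, mul_assoc ν₂]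
      field_simp
      ring
    have habs : |S - E| ≤ D * (Real.sqrt M / (2 * D)) := by
      rw [hdiff]
      calc _ ≤ |a₁| * c₁ * (r ^ 2 * t) + |a₂| * c₂ * (r ^ 2 * t) :=
            (abs_add_le _ _).trans (add_le_add (hfac hc₁ (Real.abs_sin_le_one _))
              (hfac hc₂ (Real.abs_sin_le_one _)))
        _ = D * (r ^ 2 * t) := by ring
        _ ≤ _ := by gcongr
    have hsq : (S - E) ^ 2 ≤ M / 4 := by
      have h₁ : D * (Real.sqrt M / (2 * D)) = Real.sqrt M / 2 := by field_simp
      rw [h₁] at habs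
      calc (S - E) ^ 2 = |S - E| ^ 2 := (sq_abs _).symm
        _ ≤ (Real.sqrt M / 2) ^ 2 := by gcongr
        _ = M / 4 := by rw [div_pow, Real.sq_sqrt hMpos.le]; norm_num
    nlinarith [sq_nonneg (S - 2 * E)]

lemma sub_le_setIntegral_Ioc_of_hasDerivAt {f Φ Φ' : ℝ → ℝ} {a b R : ℝ} (ha : 0 ≤ a) (hab : a ≤ b)
    (hbR : b ≤ R) (hint : IntegrableOn f (Set.Icc 0 R)) (hf : ∀ r ∈ Set.Ioc 0 R, 0 ≤ f r)
    (hcont : ContinuousOn Φ (Set.Icc a b)) (hderiv : ∀ r ∈ Set.Ioo a b, HasDerivAt Φ (Φ' r) r)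
    (hle : ∀ r ∈ Set.Ioo a b, Φ' r ≤ f r) : Φ b - Φ a ≤ ∫ r in Set.Ioc 0 R, f r := by
  have h := intervalIntegral.sub_le_integral_of_hasDeriv_right_of_le hab hcont
    (fun r hr => (hderiv r hr).hasDerivWithinAt) (hint.mono_set (Set.Icc_subset_Icc ha hbR)) hle
  rw [intervalIntegral.integral_of_le hab] at h
  refine h.trans (setIntegral_mono_set (hint.mono_set Set.Ioc_subset_Icc_self)
    ((ae_restrict_iff' measurableSet_Ioc).2 (.of_forall hf))
    (Set.Ioc_subset_Ioc ha hbR).eventuallyLE)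

lemma le_radial_dampedMode_comb_one {ν₁ ν₂ c₁ c₂ A B R : ℝ} (hν₁ : 0 < ν₁) (hν₂ : 0 < ν₂)
    (hc₁ : 0 < c₁) (hc₂ : 0 < c₂) (hA : A < 0) (hB : 0 < B) (hR : 0 < R) :
    ∃ c > 0, ∀ᶠ t in Filter.atTop, c * (1 + t) ≤ ∫ r in Set.Ioc 0 R,
      r ^ 0 * (A * dampedMode ν₁ c₁ t r - B * dampedMode ν₂ c₂ t r) ^ 2 := by
  set η := π / (2 * (ν₁ + ν₂)) with hη
  have hηpos : 0 < η := by positivity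
  set k := A * (2 / π * Real.exp (-(c₁ * η ^ 2))) with hk
  have hkneg : k < 0 := mul_neg_of_neg_of_pos hA (by positivity)
  refine ⟨k ^ 2 * η / 2, by have := sq_pos_of_neg hkneg; positivity, ?_⟩
  filter_upwards [Filter.eventually_ge_atTop 1, Filter.eventually_ge_atTop (η / R)] with t ht htR
  have ht₀ : 0 < t := by linarith
  have hb : η / t ≤ R := by
    rw [div_le_iff₀ hR] at htR
    rw [div_le_iff₀ ht₀]
    linarith
  have h := sub_le_setIntegral_Ioc_of_hasDerivAt (Φ := fun r => (k * t) ^ 2 * r)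
    (Φ' := fun _ => (k * t) ^ 2) le_rfl (by positivity : 0 ≤ η / t) hb
    (integrableOn_dampedMode_comb 0 A B R hν₁ hν₂ hc₁.le hc₂.le ht₀.le)
    (fun r _ => by positivity) (by fun_prop)
    (fun r _ => by simpa using (hasDerivAt_id r).const_mul ((k * t) ^ 2)) (fun r hr => ?_)
  · refine le_trans ?_ h
    have h₁ : (k * t) ^ 2 * (η / t) - (k * t) ^ 2 * 0 = k ^ 2 * η / 2 * (2 * t) := by
      field_simp
      ring
    simp only [h₁]
    gcongr
    linarith
  · obtain ⟨hr₀, hrη⟩ := hr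
    have hrt : r * t ≤ η := ((lt_div_iff₀ ht₀).1 hrη).le
    have hphase : ∀ {ν : ℝ}, 0 < ν → ν ≤ ν₁ + ν₂ → ν * r * t ≤ π / 2 := fun {ν} hν hle => by
      calc ν * r * t = ν * (r * t) := mul_assoc _ _ _
        _ ≤ (ν₁ + ν₂) * η := by gcongr
        _ = π / 2 := by rw [hη]; field_simp
    have hmode : ∀ {ν c : ℝ}, 0 < ν → ν ≤ ν₁ + ν₂ →
        2 / π * Real.exp (-(c * r ^ 2 * t)) * t ≤ dampedMode ν c t r := fun {ν c} hν hle => by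
      have hsin := Real.mul_le_sin (by positivity : 0 ≤ ν * r * t) (hphase hν hle)
      calc _ = 2 / π * (ν * r * t) / (ν * r) * Real.exp (-(c * r ^ 2 * t)) := by field_simp
        _ ≤ _ := by rw [dampedMode]; gcongr
    have h₁ : 2 / π * Real.exp (-(c₁ * η ^ 2)) * t ≤ dampedMode ν₁ c₁ t r := by
      refine le_trans ?_ (hmode hν₁ (by linarith))
      have : r ^ 2 * t ≤ η ^ 2 := by
        calc r ^ 2 * t ≤ r ^ 2 * t * t := le_mul_of_one_le_right (by positivity) ht
          _ = (r * t) ^ 2 := by ring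
          _ ≤ η ^ 2 := by gcongr
      rw [mul_assoc c₁]
      gcongr
    have h₂ : 0 ≤ dampedMode ν₂ c₂ t r := le_trans (by positivity) (hmode hν₂ (by linarith))
    have h₃ : A * dampedMode ν₁ c₁ t r ≤ k * t := by
      rw [hk, mul_assoc]
      exact mul_le_mul_of_nonpos_left h₁ hA.le
    have h₄ := mul_nonneg hB.le h₂
    rw [pow_zero, one_mul]
    have h₅ : k * t < 0 := mul_neg_of_neg_of_pos hkneg ht₀
    nlinarith

lemma le_radial_dampedMode_comb_two {ν₁ ν₂ c₁ c₂ A B R : ℝ} (hν₁ : 0 < ν₁) (hν₂ : 0 < ν₂)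
    (hν : ν₁ ≠ ν₂) (hc₁ : 0 < c₁) (hc₂ : 0 < c₂) (hA : A ≠ 0) (hR : 0 < R) :
    ∃ c > 0, ∀ᶠ t in Filter.atTop, c * Real.log (Real.exp 1 + t) ≤ ∫ r in Set.Ioc 0 R,
      r ^ 1 * (A * dampedMode ν₁ c₁ t r - B * dampedMode ν₂ c₂ t r) ^ 2 := by
  obtain ⟨m, hm, σ, hσ, K, Q, q, hQ, hQ', hlow⟩ :=
    exists_lower_bound_dampedMode_comb (B := B) hν₁ hν₂ hν hc₁ hc₂ hA
  refine ⟨m / 8, by positivity, ?_⟩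
  filter_upwards [Filter.eventually_ge_atTop 3, Filter.eventually_ge_atTop (1 / σ),
    Filter.eventually_ge_atTop (σ / R ^ 2),
    Real.tendsto_log_atTop.eventually_ge_atTop ((2 * K - m / 2 * Real.log σ) / (m / 4))]
    with t ht htσ htR htlog
  have ht₀ : 0 < t := by linarith
  set s := Real.sqrt (σ / t) with hs
  have hspos : 0 < s := Real.sqrt_pos.2 (by positivity)
  have hs_sq : s ^ 2 * t = σ := by
    rw [hs, Real.sq_sqrt (by positivity)]
    field_simp
  have hsR : s ≤ R := by
    rw [hs, Real.sqrt_le_left hR.le, div_le_iff₀ ht₀]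
    rw [div_le_iff₀ (by positivity)] at htR
    linarith
  have hs_ge : 1 / t ≤ s := by
    apply Real.le_sqrt_of_sq_le
    rw [div_le_iff₀ hσ] at htσ
    rw [div_pow, one_pow, div_le_div_iff₀ (by positivity) ht₀]
    nlinarith
  have hne : ∀ r ∈ Set.Icc (1 / t) s, 0 < r := fun r hr => lt_of_lt_of_le (by positivity) hr.1
  have hΦ : ∀ r > 0, HasDerivAt (fun r => m * Real.log r + (Q (r * t) + K) / (r * t))
      (m * r⁻¹ + (q (r * t) / r - (Q (r * t) + K) / (r ^ 2 * t))) r := fun r hr => by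
    have hlin : HasDerivAt (fun r => r * t) t r := by simpa using (hasDerivAt_id r).mul_const t
    have hquot := (((hQ' (r * t)).comp r hlin).add_const K).div hlin (by positivity)
    refine (((Real.hasDerivAt_log hr.ne').const_mul m).add hquot).congr_deriv ?_
    simp only [Function.comp_apply]
    field_simp
  have h := sub_le_setIntegral_Ioc_of_hasDerivAt
    (by positivity : 0 ≤ 1 / t) hs_ge hsR
    (integrableOn_dampedMode_comb 1 A B R hν₁ hν₂ hc₁.le hc₂.le ht₀.le)
    (fun r hr => by have := hr.1; positivity)
    (fun r hr => (hΦ r (hne r hr)).continuousAt.continuousWithinAt)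
    (fun r hr => hΦ r (hne r (Set.Ioo_subset_Icc_self hr))) (fun r hr => ?_)
  · refine le_trans ?_ h
    have hlog_s : Real.log s = (Real.log σ - Real.log t) / 2 := by
      rw [hs, Real.log_sqrt (by positivity), Real.log_div hσ.ne' ht₀.ne']
    have hlog_e : Real.log (Real.exp 1 + t) ≤ 2 * Real.log t := by
      have h₂ : 2 * Real.log t = Real.log (t ^ 2) := by rw [Real.log_pow]; norm_num
      rw [h₂]
      apply Real.log_le_log (by positivity)
      have := Real.exp_one_lt_d9
      nlinarith
    rw [div_le_iff₀ (by positivity)] at htlog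
    have hK₁ : (Q (1 / t * t) + K) / (1 / t * t) ≤ 2 * K := by
      rw [one_div_mul_cancel ht₀.ne', div_one]
      linarith [(abs_le.1 (hQ 1)).2]
    have hK₂ : 0 ≤ (Q (s * t) + K) / (s * t) :=
      div_nonneg (by linarith [(abs_le.1 (hQ (s * t))).1]) (by positivity)
    simp only [hlog_s, one_div, Real.log_inv] at hK₁ ⊢
    nlinarith
  · have hr₀ := hne r (Set.Ioo_subset_Icc_self hr)
    have hrσ : r ^ 2 * t ≤ σ := by
      rw [← hs_sq]
      have := hr.2.le
      gcongr
    have hpt := hlow t ht₀.le r hr₀ hrσ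
    have hQK : 0 ≤ (Q (r * t) + K) / (r ^ 2 * t) :=
      div_nonneg (by linarith [(abs_le.1 (hQ (r * t))).1]) (by positivity)
    calc _ ≤ (m + q (r * t)) / r := by
          rw [add_div m, ← div_eq_mul_inv, ← add_sub_assoc]
          exact sub_le_self _ hQK
      _ ≤ (r * (A * dampedMode ν₁ c₁ t r - B * dampedMode ν₂ c₂ t r)) ^ 2 / r := by gcongr
      _ = _ := by field_simp

lemma le_radial_dampedMode_comb_add_three (p : ℕ) {ν₁ ν₂ c₁ c₂ A B R : ℝ} (hν₁ : 0 < ν₁)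
    (hν₂ : 0 < ν₂) (hν : ν₁ ≠ ν₂) (hc₁ : 0 < c₁) (hc₂ : 0 < c₂) (hA : A ≠ 0) (hR : 0 < R) :
    ∃ c > 0, ∀ᶠ t in Filter.atTop, c * (1 + t) ^ (-((p : ℝ) + 1) / 2) ≤ ∫ r in Set.Ioc 0 R,
      r ^ (p + 2) * (A * dampedMode ν₁ c₁ t r - B * dampedMode ν₂ c₂ t r) ^ 2 := by
  obtain ⟨m, hm, σ, hσ, K, Q, q, hQ, hQ', hlow⟩ :=
    exists_lower_bound_dampedMode_comb (B := B) hν₁ hν₂ hν hc₁ hc₂ hA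
  refine ⟨m / (2 * (p + 1)) * σ ^ (((p : ℝ) + 1) / 2), by positivity, ?_⟩
  filter_upwards [Filter.eventually_gt_atTop 0, Filter.eventually_ge_atTop (σ / R ^ 2),
    Filter.eventually_ge_atTop ((4 * K * (p + 1) / m) ^ 2 / σ)] with t ht₀ htR htK
  have hK : 0 ≤ K := (abs_nonneg _).trans (hQ 0)
  set s := Real.sqrt (σ / t) with hs
  have hspos : 0 < s := Real.sqrt_pos.2 (by positivity)
  have hs_sq : s ^ 2 * t = σ := by
    rw [hs, Real.sq_sqrt (by positivity)]
    field_simp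
  have hsR : s ≤ R := by
    rw [hs, Real.sqrt_le_left hR.le, div_le_iff₀ ht₀]
    rw [div_le_iff₀ (by positivity)] at htR
    linarith
  have hst : 4 * K * (p + 1) / m ≤ s * t := by
    refine abs_le_of_sq_le_sq' ?_ (by positivity) |>.2
    rw [div_le_iff₀ hσ] at htK
    calc _ ≤ t * σ := htK
      _ = (s * t) ^ 2 := by rw [← hs_sq]; ring
  have hΦ : ∀ r : ℝ, HasDerivAt
      (fun r => m * (r ^ (p + 1) / (p + 1)) + (Q (r * t) - K) * r ^ p / t)
      (m * r ^ p + (q (r * t) * r ^ p + (Q (r * t) - K) * (p * r ^ (p - 1)) / t)) r := fun r => by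
    have hlin : HasDerivAt (fun r => r * t) t r := by simpa using (hasDerivAt_id r).mul_const t
    have hprod := ((((hQ' (r * t)).comp r hlin).sub_const K).mul (hasDerivAt_pow p r)).div_const t
    refine ((((hasDerivAt_pow (p + 1) r).div_const ((p : ℝ) + 1)).const_mul m).add
      hprod).congr_deriv ?_
    simp only [Function.comp_apply, add_tsub_cancel_right]
    push_cast
    field_simp
  have h := sub_le_setIntegral_Ioc_of_hasDerivAt le_rfl hspos.le hsR
    (integrableOn_dampedMode_comb (p + 2) A B R hν₁ hν₂ hc₁.le hc₂.le ht₀.le)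
    (fun r hr => by have := hr.1; positivity)
    (fun r _ => (hΦ r).continuousAt.continuousWithinAt) (fun r _ => hΦ r) (fun r hr => ?_)
  · refine le_trans ?_ h
    have hzero : m * ((0 : ℝ) ^ (p + 1) / (p + 1)) + (Q (0 * t) - K) * 0 ^ p / t ≤ 0 := by
      rw [zero_pow (Nat.succ_ne_zero p), zero_div, mul_zero, zero_add]
      refine div_nonpos_of_nonpos_of_nonneg (mul_nonpos_of_nonpos_of_nonneg ?_ (by positivity))
        ht₀.le
      linarith [(abs_le.1 (hQ (0 * t))).2]
    have hosc : -(2 * K) * s ^ p / t ≤ (Q (s * t) - K) * s ^ p / t := by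
      gcongr
      linarith [(abs_le.1 (hQ (s * t))).1]
    have hmain : m / (2 * (p + 1)) * s ^ (p + 1)
        ≤ m * (s ^ (p + 1) / (p + 1)) + -(2 * K) * s ^ p / t := by
      rw [div_le_iff₀ hm] at hst
      have : 2 * K * s ^ p / t ≤ m / (2 * (p + 1)) * s ^ (p + 1) := by
        rw [div_mul_eq_mul_div, div_le_div_iff₀ ht₀ (by positivity), pow_succ]
        nlinarith [mul_le_mul_of_nonneg_left hst (pow_nonneg hspos.le p)]
      have heq : m * (s ^ (p + 1) / (p + 1)) = 2 * (m / (2 * (p + 1)) * s ^ (p + 1)) := by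
        field_simp
      rw [heq, neg_mul, neg_div]
      linarith
    have hpow : σ ^ (((p : ℝ) + 1) / 2) * (1 + t) ^ (-((p : ℝ) + 1) / 2) ≤ s ^ (p + 1) := by
      rw [hs, Real.sqrt_eq_rpow, ← Real.rpow_natCast, ← Real.rpow_mul (by positivity), neg_div,
        Real.rpow_neg (by positivity), ← div_eq_mul_inv, ← Real.div_rpow hσ.le (by positivity)]
      have hexp : 1 / 2 * ((p + 1 : ℕ) : ℝ) = ((p : ℝ) + 1) / 2 := by push_cast; ring
      rw [hexp]
      gcongr
      linarith
    calc _ = m / (2 * (p + 1))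
          * (σ ^ (((p : ℝ) + 1) / 2) * (1 + t) ^ (-((p : ℝ) + 1) / 2)) := mul_assoc _ _ _
      _ ≤ m / (2 * (p + 1)) * s ^ (p + 1) := by gcongr
      _ ≤ _ := by linarith
  · obtain ⟨hr₀, hrs⟩ := hr
    have hrσ : r ^ 2 * t ≤ σ := by
      rw [← hs_sq]
      gcongr
    have hpt := hlow t ht₀.le r hr₀ hrσ
    have hQK : (Q (r * t) - K) * (p * r ^ (p - 1)) / t ≤ 0 := by
      refine div_nonpos_of_nonpos_of_nonneg (mul_nonpos_of_nonpos_of_nonneg ?_ (by positivity))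
        ht₀.le
      linarith [(abs_le.1 (hQ (r * t))).2]
    calc _ ≤ r ^ p * (m + q (r * t)) := by linarith
      _ ≤ r ^ p * (r * (A * dampedMode ν₁ c₁ t r - B * dampedMode ν₂ c₂ t r)) ^ 2 := by gcongr
      _ = _ := by ring

lemma le_radial_dampedMode_comb {n : ℕ} (hn : 1 ≤ n) {ν₁ ν₂ c₁ c₂ A B R : ℝ} (hν₁ : 0 < ν₁)
    (hν₂ : 0 < ν₂) (hν : ν₁ ≠ ν₂) (hc₁ : 0 < c₁) (hc₂ : 0 < c₂) (hA : A < 0) (hB : 0 < B)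
    (hR : 0 < R) :
    ∃ c > 0, ∀ᶠ t in Filter.atTop, c * Erate n t ^ 2 ≤ ∫ r in Set.Ioc 0 R,
      r ^ (n - 1) * (A * dampedMode ν₁ c₁ t r - B * dampedMode ν₂ c₂ t r) ^ 2 := by
  match n, hn with
  | 1, _ =>
    obtain ⟨c, hc, h⟩ := le_radial_dampedMode_comb_one hν₁ hν₂ hc₁ hc₂ hA hB hR
    refine ⟨c, hc, ?_⟩
    filter_upwards [h, Filter.eventually_ge_atTop 0] with t h ht
    rwa [Erate_one_sq ht]
  | 2, _ =>
    obtain ⟨c, hc, h⟩ := le_radial_dampedMode_comb_two (B := B) hν₁ hν₂ hν hc₁ hc₂ hA.ne hR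
    refine ⟨c, hc, ?_⟩
    filter_upwards [h, Filter.eventually_ge_atTop 0] with t h ht
    rwa [Erate_two_sq ht]
  | p + 3, _ =>
    obtain ⟨c, hc, h⟩ := le_radial_dampedMode_comb_add_three p (B := B) hν₁ hν₂ hν hc₁ hc₂ hA.ne hR
    refine ⟨c, hc, ?_⟩
    filter_upwards [h, Filter.eventually_ge_atTop 0] with t h ht
    rwa [Erate_add_three_sq p ht]

theorem typeIII_sine_kernel_weak_singularity_optimal
    (n : ℕ) (hn : 1 ≤ n) (ε0 : ℝ) (hε0 : 0 < ε0)
    (b κ γ δ : ℝ) (hb : 0 < b) (hκ : 0 < κ) (hγ : γ ≠ 0) (hδ : 0 < δ)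
    (α0 α1 α2 ν1 ν2 c1 c2 : ℝ)
    (hα0 : α0 = b ^ 2 - κ - γ ^ 2) (hα1 : α1 = b ^ 2 + κ + γ ^ 2)
    (hα2 : α2 = Real.sqrt (α1 ^ 2 - 4 * b ^ 2 * κ))
    (hν1 : ν1 = Real.sqrt ((α1 + α2) / 2)) (hν2 : ν2 = Real.sqrt ((α1 - α2) / 2))
    (hc1 : c1 = δ / 4 * (1 - α0 / α2)) (hc2 : c2 = δ / 4 * (1 + α0 / α2)) :
    (∃ C > 0, ∀ t > 0,
        Real.sqrt (∫ ξ in {ξ : EuclideanSpace ℝ (Fin n) | ‖ξ‖ ≤ ε0},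
          1 / (4 * α2 ^ 2)
            * |(α0 - α2) * (Real.sin (ν1 * ‖ξ‖ * t) / (ν1 * ‖ξ‖))
                  * Real.exp (-(c1 * ‖ξ‖ ^ 2 * t))
                - (α0 + α2) * (Real.sin (ν2 * ‖ξ‖ * t) / (ν2 * ‖ξ‖))
                  * Real.exp (-(c2 * ‖ξ‖ ^ 2 * t))| ^ 2)
          ≤ C * Erate n t)
      ∧ ((n = 2 →
            (α0 - α2) ^ 2 * (α1 - α2) > 2 * (α0 + α2) ^ 2 * (α1 + α2)
              ∨ (α0 + α2) ^ 2 * (α1 + α2) > 2 * (α0 - α2) ^ 2 * (α1 - α2)) →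
          ∃ c > 0, ∃ T > 0, ∀ t ≥ T,
            c * Erate n t
              ≤ Real.sqrt (∫ ξ in {ξ : EuclideanSpace ℝ (Fin n) | ‖ξ‖ ≤ ε0},
                  1 / (4 * α2 ^ 2)
                    * |(α0 - α2) * (Real.sin (ν1 * ‖ξ‖ * t) / (ν1 * ‖ξ‖))
                          * Real.exp (-(c1 * ‖ξ‖ ^ 2 * t))
                        - (α0 + α2) * (Real.sin (ν2 * ‖ξ‖ * t) / (ν2 * ‖ξ‖))
                          * Real.exp (-(c2 * ‖ξ‖ ^ 2 * t))| ^ 2)) := by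
  have hγ2 : 0 < γ ^ 2 := by positivity
  have hrad : α1 ^ 2 - 4 * b ^ 2 * κ = α0 ^ 2 + 4 * b ^ 2 * γ ^ 2 := by rw [hα0, hα1]; ring
  have hα2pos : 0 < α2 := by rw [hα2, hrad]; positivity
  have hα2sq : α2 ^ 2 = α0 ^ 2 + 4 * b ^ 2 * γ ^ 2 := by
    rw [hα2, hrad, Real.sq_sqrt (by positivity)]
  have habs : |α0| < α2 := abs_lt_of_sq_lt_sq (by rw [hα2sq]; nlinarith [mul_pos (pow_pos hb 2) hγ2])
    hα2pos.le
  obtain ⟨hneg, hlt⟩ := abs_lt.1 habs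
  have hα1pos : 0 < α1 := by rw [hα1]; positivity
  have hα21 : α2 < α1 := by
    refine lt_of_pow_lt_pow_left₀ 2 hα1pos.le ?_
    nlinarith [mul_pos (pow_pos hb 2) hκ]
  have hν2pos : 0 < ν2 := by rw [hν2]; exact Real.sqrt_pos.2 (by linarith)
  have hν21 : ν2 < ν1 := by rw [hν1, hν2]; exact Real.sqrt_lt_sqrt (by linarith) (by linarith)
  have hν1pos : 0 < ν1 := hν2pos.trans hν21
  have hc1pos : 0 < c1 := by
    rw [hc1]
    exact mul_pos (by positivity) (sub_pos.2 ((div_lt_one hα2pos).2 hlt))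
  have hc2pos : 0 < c2 := by
    rw [hc2]
    refine mul_pos (by positivity) ?_
    have : -1 < α0 / α2 := by rw [lt_div_iff₀ hα2pos]; linarith
    linarith
  set W := 1 / (4 * α2 ^ 2) * (n * volume.real (Metric.ball (0 : EuclideanSpace ℝ (Fin n)) 1))
    with hW
  have hWpos : 0 < W := by
    have hn' : (0 : ℝ) < n := by exact_mod_cast hn
    have : 0 < volume.real (Metric.ball (0 : EuclideanSpace ℝ (Fin n)) 1) :=
      ENNReal.toReal_pos (Metric.measure_ball_pos _ _ one_pos).ne' measure_ball_lt_top.ne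
    positivity
  have hpolar : ∀ t, (∫ ξ in {ξ : EuclideanSpace ℝ (Fin n) | ‖ξ‖ ≤ ε0},
        1 / (4 * α2 ^ 2)
          * |(α0 - α2) * (Real.sin (ν1 * ‖ξ‖ * t) / (ν1 * ‖ξ‖))
                * Real.exp (-(c1 * ‖ξ‖ ^ 2 * t))
              - (α0 + α2) * (Real.sin (ν2 * ‖ξ‖ * t) / (ν2 * ‖ξ‖))
                * Real.exp (-(c2 * ‖ξ‖ ^ 2 * t))| ^ 2)
      = W * ∫ r in Set.Ioc 0 ε0, r ^ (n - 1)
          * ((α0 - α2) * dampedMode ν1 c1 t r - (α0 + α2) * dampedMode ν2 c2 t r) ^ 2 := by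
    intro t
    have h := setIntegral_norm_le_eq_radial hn ε0 fun r =>
      ((α0 - α2) * dampedMode ν1 c1 t r - (α0 + α2) * dampedMode ν2 c2 t r) ^ 2
    rw [hW, mul_assoc, ← h, ← integral_const_mul]
    simp only [dampedMode, sq_abs, mul_assoc]
  simp only [hpolar]
  constructor
  · obtain ⟨C, hC, h⟩ := radial_dampedMode_comb_le hn (α0 - α2) (α0 + α2) hν1pos hν2pos hc1pos
      hc2pos hε0.le
    refine ⟨Real.sqrt (W * C), by positivity, fun t ht => ?_⟩
    rw [← Real.sqrt_sq (Erate_nonneg n ht.le), ← Real.sqrt_mul (by positivity)]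
    refine Real.sqrt_le_sqrt ?_
    rw [mul_assoc W]
    exact mul_le_mul_of_nonneg_left (h t ht.le) hWpos.le
  · intro _
    obtain ⟨c, hc, h⟩ := le_radial_dampedMode_comb hn hν1pos hν2pos hν21.ne' hc1pos hc2pos
      (by linarith : α0 - α2 < 0) (by linarith : 0 < α0 + α2) hε0
    obtain ⟨T, hT⟩ := Filter.eventually_atTop.1 h
    refine ⟨Real.sqrt (W * c), by positivity, max T 1, by positivity, fun t ht => ?_⟩
    have ht₀ : 0 ≤ t := zero_le_one.trans ((le_max_right T 1).trans ht)
    rw [← Real.sqrt_sq (Erate_nonneg n ht₀), ← Real.sqrt_mul (by positivity)]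
    refine Real.sqrt_le_sqrt ?_
    rw [mul_assoc W]
    exact mul_le_mul_of_nonneg_left (hT t ((le_max_left T 1).trans ht)) hWpos.le
end

section
/- Let b, κ, δ be positive reals, γ a nonzero real, and ρ > 0. Then the characteristic quartic of the type III thermoelastic system has no purely imaginary root: for every real number μ, (iμ)⁴ + δρ·(iμ)³ + (b²+κ+γ²)ρ·(iμ)² + b²δρ²·(iμ) + b²κρ² ≠ 0 in ℂ. -/
open Complex

theorem typeIII_no_purely_imaginary_root
    (b κ δ γ ρ : ℝ) (hb : 0 < b) (hκ : 0 < κ) (hδ : 0 < δ) (hγ : γ ≠ 0)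
    (hρ : 0 < ρ) (μ : ℝ) :
    (Complex.I * (μ : ℂ)) ^ 4
      + ((δ * ρ : ℝ) : ℂ) * (Complex.I * (μ : ℂ)) ^ 3
      + (((b ^ 2 + κ + γ ^ 2) * ρ : ℝ) : ℂ) * (Complex.I * (μ : ℂ)) ^ 2
      + ((b ^ 2 * δ * ρ ^ 2 : ℝ) : ℂ) * (Complex.I * (μ : ℂ))
      + ((b ^ 2 * κ * ρ ^ 2 : ℝ) : ℂ) ≠ 0 := by
  intro h
  have key : (((μ ^ 4 - (b ^ 2 + κ + γ ^ 2) * ρ * μ ^ 2 + b ^ 2 * κ * ρ ^ 2 : ℝ) : ℂ)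
      + ((δ * ρ * (μ * (b ^ 2 * ρ - μ ^ 2)) : ℝ) : ℂ) * Complex.I) = 0 := by
    rw [← h]
    have hI3 : Complex.I ^ 3 = -Complex.I := Complex.I_pow_three
    simp only [mul_pow, Complex.I_sq, hI3, Complex.I_pow_four]
    push_cast
    ring
  have hre : μ ^ 4 - (b ^ 2 + κ + γ ^ 2) * ρ * μ ^ 2 + b ^ 2 * κ * ρ ^ 2 = 0 := by
    simpa only [Complex.add_re, Complex.ofReal_re, Complex.re_ofReal_mul, Complex.I_re,
      mul_zero, add_zero, Complex.zero_re] using congrArg Complex.re key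
  have him : δ * ρ * (μ * (b ^ 2 * ρ - μ ^ 2)) = 0 := by
    simpa only [Complex.add_im, Complex.ofReal_im, Complex.im_ofReal_mul, Complex.I_im,
      mul_one, zero_add, Complex.zero_im] using congrArg Complex.im key
  rcases mul_eq_zero.mp ((mul_eq_zero.mp him).resolve_left (by positivity)) with h0 | h1
  · have hpos : 0 < b ^ 2 * κ * ρ ^ 2 := by positivity
    rw [h0] at hre
    linarith
  · have hsq : μ ^ 2 = b ^ 2 * ρ := by linarith
    have hpos : 0 < γ ^ 2 * b ^ 2 * ρ ^ 2 := by positivity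
    have hval : γ ^ 2 * b ^ 2 * ρ ^ 2 = 0 := by
      linear_combination -hre + (μ ^ 2 + b ^ 2 * ρ - (b ^ 2 + κ + γ ^ 2) * ρ) * hsq
    exact hpos.ne' hval
end

section
/- Pointwise error estimate for the temperature difference of the type II thermoelastic system in the Fourier space: let n ≥ 1 and let b, κ, γ and the derived constants α0, α2, ν1, ν2 be as in the thermoelastic type II parameter setting, and set Ĝ₄(t,|ξ|) := −(1/(2α2))·( (α0−α2)·sin(ν1|ξ|t)/(ν1|ξ|) − (α0+α2)·sin(ν2|ξ|t)/(ν2|ξ|) ). Then there exists a constant C > 0, depending only on b, κ, γ, such that for all functions v0, v1 : ℝⁿ → ℂⁿ and w0, w1 : ℝⁿ → ℂ, all t ≥ 0 and all ξ ∈ ℝⁿ \ {0}, the function Θ(t,ξ) := (ν2²−ν1²)^{−1} · [ i b² γ·(cos(ν1|ξ|t) − cos(ν2|ξ|t))·(ξ·v0(ξ)) + i b² γ·(sin(ν1|ξ|t)/(ν1|ξ|) − sin(ν2|ξ|t)/(ν2|ξ|))·(ξ·v1(ξ)) + ((ν2²−κ−γ²)cos(ν1|ξ|t) − (ν1²−κ−γ²)cos(ν2|ξ|t))·w0(ξ)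 + ((ν2²−κ−γ²)·sin(ν1|ξ|t)/(ν1|ξ|) − (ν1²−κ−γ²)·sin(ν2|ξ|t)/(ν2|ξ|))·w1(ξ) ] satisfies |Θ(t,ξ) − Ĝ₄(t,|ξ|)·w1(ξ)| ≤ C·( |ξ|·|v0(ξ)| + |v1(ξ)| + |w0(ξ)| ). -/
open MeasureTheory Real

/-- Cauchy-Schwarz for the bilinear pairing of a real vector with a complex vector. -/
theorem norm_sum_ofReal_mul_le {ι : Type*} [Fintype ι] (x : EuclideanSpace ℝ ι)
    (v : EuclideanSpace ℂ ι) : ‖∑ k, ((x k : ℝ) : ℂ) * v k‖ ≤ ‖x‖ * ‖v‖ := by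
  rw [EuclideanSpace.norm_eq, EuclideanSpace.norm_eq]
  refine (norm_sum_le _ _).trans ?_
  simpa only [norm_mul, Complex.norm_real] using
    Real.sum_mul_le_sqrt_mul_sqrt Finset.univ (fun k => ‖x k‖) (fun k => ‖v k‖)

theorem abs_sin_div_sub_sin_div_mul_le {μ ν r : ℝ} (hμ : 0 < μ) (hν : 0 < ν) (hr : 0 < r)
    (x y : ℝ) : |Real.sin x / (μ * r) - Real.sin y / (ν * r)| * r ≤ 1 / μ + 1 / ν := by
  have h : (Real.sin x / (μ * r) - Real.sin y / (ν * r)) * r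
      = Real.sin x / μ - Real.sin y / ν := by
    field_simp
  rw [← abs_of_pos hr, ← abs_mul, abs_of_pos hr, h]
  refine (abs_sub _ _).trans ?_
  rw [abs_div, abs_div, abs_of_pos hμ, abs_of_pos hν]
  gcongr
  · exact Real.abs_sin_le_one x
  · exact Real.abs_sin_le_one y

theorem abs_mul_cos_sub_mul_cos_le (p q x y : ℝ) :
    |p * Real.cos x - q * Real.cos y| ≤ |p| + |q| := by
  refine (abs_sub _ _).trans ?_
  rw [abs_mul, abs_mul]
  exact add_le_add (mul_le_of_le_one_right (abs_nonneg p) (Real.abs_cos_le_one x))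
    (mul_le_of_le_one_right (abs_nonneg q) (Real.abs_cos_le_one y))

theorem typeII_temperature_pointwise_error_estimate
    (b κ γ : ℝ) (hb : 0 < b) (hκ : 0 < κ) (hγ : γ ≠ 0)
    (α0 α1 α2 ν1 ν2 : ℝ)
    (hα0 : α0 = b ^ 2 - κ - γ ^ 2) (hα1 : α1 = b ^ 2 + κ + γ ^ 2)
    (hα2 : α2 = Real.sqrt (α1 ^ 2 - 4 * b ^ 2 * κ))
    (hν1 : ν1 = Real.sqrt ((α1 + α2) / 2)) (hν2 : ν2 = Real.sqrt ((α1 - α2) / 2)) :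
    ∃ C > 0,
      ∀ (n : ℕ), 1 ≤ n →
      ∀ (v0 v1 : EuclideanSpace ℝ (Fin n) → EuclideanSpace ℂ (Fin n))
        (w0 w1 : EuclideanSpace ℝ (Fin n) → ℂ),
      ∀ t : ℝ, 0 ≤ t →
      ∀ ξ : EuclideanSpace ℝ (Fin n), ξ ≠ 0 →
        ‖(((ν2 ^ 2 - ν1 ^ 2 : ℝ) : ℂ))⁻¹ *
            (Complex.I * ((b ^ 2 : ℝ) : ℂ) * ((γ : ℝ) : ℂ)
                * ((Real.cos (ν1 * ‖ξ‖ * t) - Real.cos (ν2 * ‖ξ‖ * t) : ℝ) : ℂ)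
                * (∑ k, ((ξ k : ℝ) : ℂ) * v0 ξ k)
              + Complex.I * ((b ^ 2 : ℝ) : ℂ) * ((γ : ℝ) : ℂ)
                * ((Real.sin (ν1 * ‖ξ‖ * t) / (ν1 * ‖ξ‖)
                    - Real.sin (ν2 * ‖ξ‖ * t) / (ν2 * ‖ξ‖) : ℝ) : ℂ)
                * (∑ k, ((ξ k : ℝ) : ℂ) * v1 ξ k)
              + (((ν2 ^ 2 - κ - γ ^ 2) * Real.cos (ν1 * ‖ξ‖ * t)
                  - (ν1 ^ 2 - κ - γ ^ 2) * Real.cos (ν2 * ‖ξ‖ * t) : ℝ) : ℂ) * w0 ξ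
              + (((ν2 ^ 2 - κ - γ ^ 2) * (Real.sin (ν1 * ‖ξ‖ * t) / (ν1 * ‖ξ‖))
                  - (ν1 ^ 2 - κ - γ ^ 2) * (Real.sin (ν2 * ‖ξ‖ * t) / (ν2 * ‖ξ‖)) : ℝ) : ℂ)
                * w1 ξ)
          - ((-(1 / (2 * α2))
                * ((α0 - α2) * (Real.sin (ν1 * ‖ξ‖ * t) / (ν1 * ‖ξ‖))
                    - (α0 + α2) * (Real.sin (ν2 * ‖ξ‖ * t) / (ν2 * ‖ξ‖))) : ℝ) : ℂ)
              * w1 ξ‖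
          ≤ C * (‖ξ‖ * ‖v0 ξ‖ + ‖v1 ξ‖ + ‖w0 ξ‖) := by
  have hγ2 : 0 < γ ^ 2 := by positivity
  have hb2 : 0 < b ^ 2 := by positivity
  have hdisc : 0 < α1 ^ 2 - 4 * b ^ 2 * κ := by
    rw [hα1]
    nlinarith [sq_nonneg (b ^ 2 - κ), mul_pos hγ2 hb2, mul_pos hγ2 hκ, mul_pos hγ2 hγ2]
  have hα2pos : 0 < α2 := hα2 ▸ Real.sqrt_pos.2 hdisc
  have hα1pos : 0 < α1 := by rw [hα1]; positivity
  have hα21 : α2 < α1 := by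
    rw [hα2, Real.sqrt_lt' hα1pos]
    nlinarith [mul_pos hb2 hκ]
  have hν1pos : 0 < ν1 := hν1 ▸ Real.sqrt_pos.2 (by linarith)
  have hν2pos : 0 < ν2 := hν2 ▸ Real.sqrt_pos.2 (by linarith)
  have hν1sq : ν1 ^ 2 = (α1 + α2) / 2 := by rw [hν1, Real.sq_sqrt (by linarith)]
  have hν2sq : ν2 ^ 2 = (α1 - α2) / 2 := by rw [hν2, Real.sq_sqrt (by linarith)]
  have hD : ν2 ^ 2 - ν1 ^ 2 = -α2 := by rw [hν1sq, hν2sq]; ring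
  have hp : ν2 ^ 2 - κ - γ ^ 2 = (α0 - α2) / 2 := by rw [hν2sq, hα1, hα0]; ring
  have hq : ν1 ^ 2 - κ - γ ^ 2 = (α0 + α2) / 2 := by rw [hν1sq, hα1, hα0]; ring
  rw [hD, hp, hq]
  set K : ℝ := b ^ 2 * |γ| * 2 + b ^ 2 * |γ| * (1 / ν1 + 1 / ν2)
    + (|(α0 - α2) / 2| + |(α0 + α2) / 2|) with hK
  have hbγ : 0 < b ^ 2 * |γ| := mul_pos hb2 (abs_pos.2 hγ)
  refine ⟨α2⁻¹ * K, by positivity, ?_⟩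
  intro n _ v0 v1 w0 w1 t _ ξ hξ
  have hr : 0 < ‖ξ‖ := norm_pos_iff.2 hξ
  have hcos := abs_mul_cos_sub_mul_cos_le 1 1 (ν1 * ‖ξ‖ * t) (ν2 * ‖ξ‖ * t)
  have hcos' := abs_mul_cos_sub_mul_cos_le ((α0 - α2) / 2) ((α0 + α2) / 2)
    (ν1 * ‖ξ‖ * t) (ν2 * ‖ξ‖ * t)
  have hsin := abs_sin_div_sub_sin_div_mul_le hν1pos hν2pos hr (ν1 * ‖ξ‖ * t) (ν2 * ‖ξ‖ * t)
  have hS0 := norm_sum_ofReal_mul_le ξ (v0 ξ)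
  have hS1 := norm_sum_ofReal_mul_le ξ (v1 ξ)
  simp only [one_mul, abs_one] at hcos
  generalize Real.sin (ν1 * ‖ξ‖ * t) / (ν1 * ‖ξ‖) = s1 at *
  generalize Real.sin (ν2 * ‖ξ‖ * t) / (ν2 * ‖ξ‖) = s2 at *
  generalize Real.cos (ν1 * ‖ξ‖ * t) = c1 at *
  generalize Real.cos (ν2 * ‖ξ‖ * t) = c2 at *
  generalize ∑ k, ((ξ k : ℝ) : ℂ) * v0 ξ k = S0 at *
  generalize ∑ k, ((ξ k : ℝ) : ℂ) * v1 ξ k = S1 at *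
  have hcancel : -(1 / (2 * α2)) * ((α0 - α2) * s1 - (α0 + α2) * s2)
      = (-α2)⁻¹ * ((α0 - α2) / 2 * s1 - (α0 + α2) / 2 * s2) := by
    field_simp
  rw [hcancel, Complex.ofReal_mul (-α2)⁻¹, Complex.ofReal_inv, mul_assoc _ _ (w1 ξ), ← mul_sub,
    add_sub_cancel_right, norm_mul, norm_inv, Complex.norm_real, norm_neg, Real.norm_eq_abs,
    abs_of_pos hα2pos, mul_assoc α2⁻¹]
  refine mul_le_mul_of_nonneg_left ?_ (inv_nonneg.2 hα2pos.le)
  refine norm_add₃_le.trans ?_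
  simp only [norm_mul, Complex.norm_I, Complex.norm_real, Real.norm_eq_abs, one_mul,
    abs_of_pos hb2]
  have h0 : b ^ 2 * |γ| * |c1 - c2| * ‖S0‖ ≤ b ^ 2 * |γ| * 2 * (‖ξ‖ * ‖v0 ξ‖) := by
    gcongr
    linarith
  have h1 : b ^ 2 * |γ| * |s1 - s2| * ‖S1‖ ≤ b ^ 2 * |γ| * (1 / ν1 + 1 / ν2) * ‖v1 ξ‖ :=
    calc b ^ 2 * |γ| * |s1 - s2| * ‖S1‖
        ≤ b ^ 2 * |γ| * |s1 - s2| * (‖ξ‖ * ‖v1 ξ‖) := by gcongr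
      _ = b ^ 2 * |γ| * (|s1 - s2| * ‖ξ‖) * ‖v1 ξ‖ := by ring
      _ ≤ _ := by gcongr
  refine (add_le_add_three h0 h1 (mul_le_mul_of_nonneg_right hcos' (norm_nonneg _))).trans ?_
  have hν : 0 ≤ 1 / ν1 + 1 / ν2 := by positivity
  have hbγν := mul_nonneg hbγ.le hν
  have hpq : 0 ≤ |(α0 - α2) / 2| + |(α0 + α2) / 2| := by positivity
  rw [mul_add K, mul_add K]
  gcongr <;> linarith
end
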